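/- arXiv:1712.07497 — 2 statements merged into one kernel-verified Lean document; each statement's English description precedes it below -/
import Mathlib

section
/- Let d ≥ 3, Ω ⊂ ℝ^d bounded open, and f ∈ C_c^∞(Ω). Then the Newton potential u(x) = ∫_Ω (1/((d−2)s_d)) |x−y|^{2−d} f(y) dy satisfies −Δu(x) = f(x) for all x ∈ Ω. -/
open MeasureTheory Metric

open Set Filter Topology

/-- Real powers of the norm above the critical exponent are locally integrable. -/
lemma np_locInt (d : ℕ) (hd : 1 ≤ d) (α : ℝ) (hα : α < d) :
    LocallyIntegrable (fun z : EuclideanSpace ℝ (Fin d) => ‖z‖ ^ (-α)) volume := by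
  refine locallyIntegrable_of_norm_le_rpow (C := 1) (α := α) (by simpa using hd) (by simpa using hα)
    (Eventually.of_forall fun x => ?_) ?_
  · rw [Real.norm_of_nonneg (by positivity), one_mul]
  · exact (measurable_norm.pow_const _).aestronglyMeasurable

/-- Polar coordinates. -/
lemma np_polar (d : ℕ) (hd : 1 ≤ d) (F : EuclideanSpace ℝ (Fin d) → ℝ) (hF : Integrable F) (c : ℝ)
    (h : ∀ w : EuclideanSpace ℝ (Fin d), ‖w‖ = 1 →
      ∫ r in Ioi (0 : ℝ), r ^ (d - 1) * F (r • w) = c) :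
    ∫ x, F x = (d * volume.real (ball (0 : EuclideanSpace ℝ (Fin d)) 1)) * c := by
  have mp := (volume : Measure (EuclideanSpace ℝ (Fin d))).measurePreserving_homeomorphUnitSphereProd
  have emb := (homeomorphUnitSphereProd (EuclideanSpace ℝ (Fin d))).measurableEmbedding
  have key : ∀ x : ({0}ᶜ : Set (EuclideanSpace ℝ (Fin d))),
      (fun p : sphere (0 : EuclideanSpace ℝ (Fin d)) 1 × Ioi (0 : ℝ) => F (p.2.1 • p.1.1))
        (homeomorphUnitSphereProd _ x) = F x.1 := by
    intro x
    have := congrArg Subtype.val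
      ((homeomorphUnitSphereProd (EuclideanSpace ℝ (Fin d))).symm_apply_apply x)
    rw [homeomorphUnitSphereProd_symm_apply_coe] at this
    simp only [this]
  have h1 : ∫ x, F x = ∫ x : ({0}ᶜ : Set (EuclideanSpace ℝ (Fin d))), F x.1 ∂(volume.comap Subtype.val) := by
    have : Nonempty (Fin d) := ⟨⟨0, hd⟩⟩
    rw [integral_subtype_comap (measurableSet_singleton _).compl F, restrict_compl_singleton]
  have hFint : Integrable (fun x : ({0}ᶜ : Set (EuclideanSpace ℝ (Fin d))) => F x.1)
      (volume.comap Subtype.val) := by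
    have := (integrableOn_iff_comap_subtypeVal (μ := volume) (f := F)
      (measurableSet_singleton (0 : EuclideanSpace ℝ (Fin d))).compl).1 hF.integrableOn
    exact this
  have hFint2 := (mp.integrable_comp_emb emb (g := fun p : sphere (0 : EuclideanSpace ℝ (Fin d)) 1 × Ioi (0 : ℝ) => F (p.2.1 • p.1.1))).1
    (by
      refine hFint.congr (Eventually.of_forall fun x => ?_)
      exact (key x).symm)
  rw [h1, ← integral_congr_ae (Eventually.of_forall key), (mp.integral_comp emb (fun p : sphere (0 : EuclideanSpace ℝ (Fin d)) 1 × Ioi (0 : ℝ) =>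
      F (p.2.1 • p.1.1)) :), integral_prod _ hFint2]
  have : ∀ w : sphere (0 : EuclideanSpace ℝ (Fin d)) 1,
      ∫ r : Ioi (0 : ℝ), F (r.1 • w.1) ∂(Measure.volumeIoiPow
        (Module.finrank ℝ (EuclideanSpace ℝ (Fin d)) - 1)) = c := by
    intro w
    rw [← h w.1 (by simpa using w.2), finrank_euclideanSpace_fin]
    simp only [Measure.volumeIoiPow, ENNReal.ofReal]
    rw [integral_withDensity_eq_integral_smul,
      integral_subtype_comap measurableSet_Ioi fun a ↦ Real.toNNReal (a ^ (d - 1)) • F (a • w.1),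
      setIntegral_congr_fun measurableSet_Ioi fun x hx ↦ ?_]
    · rw [NNReal.smul_def, Real.coe_toNNReal _ (pow_nonneg (mem_Ioi.1 hx).le _), smul_eq_mul]
    · exact (measurable_subtype_coe.pow_const _).real_toNNReal
  simp only [this]
  rw [integral_const, Measure.toSphere_real_apply_univ, finrank_euclideanSpace_fin, smul_eq_mul]

lemma np_radial (d : ℕ) (hd : 1 ≤ d) (g : EuclideanSpace ℝ (Fin d) → ℝ) (hg : ContDiff ℝ 1 g)
    (hc : HasCompactSupport g) :
    ∫ z, ‖z‖ ^ (-(d : ℝ)) * fderiv ℝ g z z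
      = (d * volume.real (ball (0 : EuclideanSpace ℝ (Fin d)) 1)) * (- g 0) := by
  have hcont : Continuous (fderiv ℝ g) := hg.continuous_fderiv one_ne_zero
  apply np_polar d hd
  · have := (np_locInt d hd (d - 1) (by linarith)).integrable_smul_right_of_hasCompactSupport
      hcont (hc.fderiv ℝ)
    refine this.norm.mono' ?_ (Eventually.of_forall fun z => ?_)
    · refine AEStronglyMeasurable.mul (measurable_norm.pow_const _).aestronglyMeasurable ?_
      exact (hcont.clm_apply continuous_id).aestronglyMeasurable
    · rcases eq_or_ne z 0 with rfl | hz
      · simp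
      have hz' : 0 < ‖z‖ := norm_pos_iff.2 hz
      rw [norm_mul, norm_smul, Real.norm_of_nonneg (Real.rpow_nonneg (norm_nonneg z) _),
        Real.norm_of_nonneg (Real.rpow_nonneg (norm_nonneg z) _)]
      calc ‖z‖ ^ (-(d:ℝ)) * ‖fderiv ℝ g z z‖ ≤ ‖z‖ ^ (-(d:ℝ)) * (‖fderiv ℝ g z‖ * ‖z‖) := by
            gcongr; exact ContinuousLinearMap.le_opNorm _ _
        _ = (‖z‖ ^ (-(d:ℝ)) * ‖z‖ ^ (1:ℝ)) * ‖fderiv ℝ g z‖ := by rw [Real.rpow_one]; ring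
        _ = _ := by rw [← Real.rpow_add hz']; ring_nf
  · intro w hw
    have hder : ∀ r : ℝ, HasDerivAt (fun r : ℝ => g (r • w)) (fderiv ℝ g (r • w) w) r := by
      intro r
      have h1 : HasDerivAt (fun r : ℝ => r • w) w r := by
        simpa using (hasDerivAt_id r).smul_const w
      exact ((hg.differentiable one_ne_zero (r • w)).hasFDerivAt).comp_hasDerivAt r h1
    have hcd : ContDiff ℝ 1 (fun r : ℝ => g (r • w)) := hg.comp (by fun_prop)
    have hcs : HasCompactSupport (fun r : ℝ => g (r • w)) := by
      obtain ⟨R, hR⟩ := hc.isCompact.isBounded.exists_norm_le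
      refine HasCompactSupport.intro (isCompact_closedBall (0:ℝ) R) fun r hr => ?_
      by_contra hne
      have := hR _ (subset_tsupport g hne)
      rw [norm_smul, hw, mul_one] at this
      exact hr (by simpa using this)
    have := hcs.integral_Ioi_deriv_eq hcd 0
    simp only [zero_smul] at this
    rw [← this]
    refine setIntegral_congr_fun measurableSet_Ioi fun r hr => ?_
    have hr' : 0 < r := hr
    simp only [(hder r).deriv, map_smul, smul_eq_mul, norm_smul, hw, mul_one, Real.norm_of_nonneg hr'.le]
    rw [← mul_assoc, ← mul_assoc]
    have : r ^ (d-1) * r ^ (-(d:ℝ)) * r = 1 := by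
      rw [mul_right_comm, ← pow_succ, Nat.sub_add_cancel hd, ← Real.rpow_natCast, ← Real.rpow_add hr']
      simp
    rw [this, one_mul]

/-- Integration by parts with the regularised kernel. -/
lemma np_ibp_eps (d : ℕ) (ε : ℝ) (hε : 0 < ε) (h : EuclideanSpace ℝ (Fin d) → ℝ)
    (hh : ContDiff ℝ 1 h) (hc : HasCompactSupport h) (v : EuclideanSpace ℝ (Fin d)) :
    ∫ z, (‖z‖ ^ 2 + ε) ^ ((2 - (d:ℝ)) / 2) * fderiv ℝ h z v
      = (d - 2) * ∫ z, (‖z‖ ^ 2 + ε) ^ (-(d:ℝ) / 2) * inner ℝ z v * h z := by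
  have hpos : ∀ z : EuclideanSpace ℝ (Fin d), 0 < ‖z‖ ^ 2 + ε := fun z => by positivity
  have hd : ∀ z : EuclideanSpace ℝ (Fin d),
      HasFDerivAt (fun z : EuclideanSpace ℝ (Fin d) => (‖z‖ ^ 2 + ε) ^ ((2 - (d:ℝ)) / 2))
        ((((2 - (d:ℝ)) / 2) * (‖z‖ ^ 2 + ε) ^ ((2 - (d:ℝ)) / 2 - 1)) • ((2 : ℝ) • innerSL ℝ z)) z := by
    intro z
    have h1 : HasFDerivAt (fun z : EuclideanSpace ℝ (Fin d) => ‖z‖ ^ 2 + ε)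
        ((2 : ℝ) • innerSL ℝ z) z := by
      have := ((hasStrictFDerivAt_norm_sq z).hasFDerivAt).add_const ε
      rwa [← Nat.cast_smul_eq_nsmul ℝ, Nat.cast_ofNat] at this
    exact h1.rpow_const (Or.inl (hpos z).ne')
  have hfd : ∀ z, fderiv ℝ (fun z : EuclideanSpace ℝ (Fin d) => (‖z‖ ^ 2 + ε) ^ ((2 - (d:ℝ)) / 2)) z v
      = (2 - d) * ((‖z‖ ^ 2 + ε) ^ (-(d:ℝ) / 2) * inner ℝ z v) := by
    intro z
    rw [(hd z).fderiv]
    have : (2 - (d:ℝ)) / 2 - 1 = -(d:ℝ) / 2 := by ring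
    rw [this]
    simp
    ring
  have hcp : ∀ a : ℝ, Continuous (fun z : EuclideanSpace ℝ (Fin d) => (‖z‖ ^ 2 + ε) ^ a) := by
    intro a
    exact Continuous.rpow_const (by fun_prop) fun z => Or.inl (hpos z).ne'
  rw [integral_mul_fderiv_eq_neg_fderiv_mul_of_integrable]
  · simp only [hfd]
    rw [← integral_const_mul, ← integral_neg]
    congr 1; ext z; ring
  · simp only [hfd]
    refine Continuous.integrable_of_hasCompactSupport ?_ hc.mul_left
    have := hcp (-(d:ℝ)/2)
    have := hh.continuous
    fun_prop
  · refine Continuous.integrable_of_hasCompactSupport ?_ (hc.fderiv_apply ℝ v).mul_left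
    exact (hcp _).mul ((hh.continuous_fderiv one_ne_zero).clm_apply continuous_const)
  · exact Continuous.integrable_of_hasCompactSupport ((hcp _).mul hh.continuous) hc.mul_left
  · exact fun x _ => (hd x).differentiableAt
  · exact fun x _ => hh.differentiable one_ne_zero x

lemma np_tendsto (d : ℕ) (hd : 1 ≤ d) (a : ℝ) (ha : a ≤ 0) (k : EuclideanSpace ℝ (Fin d) → ℝ)
    (hk : Continuous k) (hi : Integrable fun z => ‖z‖ ^ (2 * a) * k z) :
    Tendsto (fun ε : ℝ => ∫ z, (‖z‖ ^ 2 + ε) ^ a * k z) (𝓝[>] 0)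
      (𝓝 (∫ z, ‖z‖ ^ (2 * a) * k z)) := by
  have : Nonempty (Fin d) := ⟨⟨0, hd⟩⟩
  have hne : ∀ᵐ z : EuclideanSpace ℝ (Fin d), z ≠ 0 := Measure.ae_ne volume 0
  have hsq : ∀ z : EuclideanSpace ℝ (Fin d), (‖z‖ ^ 2) ^ a = ‖z‖ ^ (2 * a) := fun z => by
    rw [Real.rpow_mul (norm_nonneg z)]; norm_num
  refine tendsto_integral_filter_of_dominated_convergence (fun z => ‖‖z‖ ^ (2 * a) * k z‖)
    ?_ ?_ hi.norm ?_
  · filter_upwards [self_mem_nhdsWithin] with ε hε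
    exact AEStronglyMeasurable.mul
      (((measurable_norm.pow_const 2).add_const ε).pow_const a).aestronglyMeasurable
      hk.aestronglyMeasurable
  · filter_upwards [self_mem_nhdsWithin] with ε hε
    have hε' : 0 < ε := hε
    filter_upwards [hne] with z hz
    have hz' : 0 < ‖z‖ := norm_pos_iff.2 hz
    rw [norm_mul, norm_mul]
    gcongr ?_ * _
    rw [Real.norm_of_nonneg (by positivity), Real.norm_of_nonneg (by positivity), ← hsq]
    exact Real.rpow_le_rpow_of_nonpos (by positivity) (by linarith) ha
  · filter_upwards [hne] with z hz
    have hz' : 0 < ‖z‖ := norm_pos_iff.2 hz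
    rw [← hsq]
    refine Tendsto.mul_const _ ?_
    have : Tendsto (fun ε : ℝ => ‖z‖ ^ 2 + ε) (𝓝[>] 0) (𝓝 (‖z‖ ^ 2)) := by
      have : Continuous (fun ε : ℝ => ‖z‖ ^ 2 + ε) := by fun_prop
      simpa using (this.tendsto 0).mono_left nhdsWithin_le_nhds
    exact this.rpow_const (Or.inl (by positivity))

lemma np_ibp (d : ℕ) (hd : 3 ≤ d) (h : EuclideanSpace ℝ (Fin d) → ℝ)
    (hh : ContDiff ℝ 1 h) (hc : HasCompactSupport h) (v : EuclideanSpace ℝ (Fin d)) :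
    Integrable (fun z => ‖z‖ ^ (2 - (d:ℝ)) * fderiv ℝ h z v) ∧
    Integrable (fun z => ‖z‖ ^ (-(d:ℝ)) * (inner ℝ z v * h z)) ∧
    ∫ z, ‖z‖ ^ (2 - (d:ℝ)) * fderiv ℝ h z v
      = (d - 2) * ∫ z, ‖z‖ ^ (-(d:ℝ)) * (inner ℝ z v * h z) := by
  have hd' : (3:ℝ) ≤ d := by exact_mod_cast hd
  have hcont := (hh.continuous_fderiv one_ne_zero).clm_apply (continuous_const (y := v))
  have I1 : Integrable (fun z => ‖z‖ ^ (2 - (d:ℝ)) * fderiv ℝ h z v) := by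
    have := (np_locInt d (by omega) (d - 2) (by linarith)).integrable_smul_right_of_hasCompactSupport
      hcont (hc.fderiv_apply ℝ v)
    simpa using this
  have I2 : Integrable (fun z => ‖z‖ ^ (-(d:ℝ)) * (inner ℝ z v * h z)) := by
    have := (np_locInt d (by omega) (d - 1) (by linarith)).integrable_smul_right_of_hasCompactSupport
      hh.continuous hc
    refine (this.norm.const_mul ‖v‖).mono' ?_ (Eventually.of_forall fun z => ?_)
    · refine AEStronglyMeasurable.mul (measurable_norm.pow_const _).aestronglyMeasurable ?_
      have := hh.continuous
      exact Continuous.aestronglyMeasurable (by fun_prop)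
    · rcases eq_or_ne z 0 with rfl | hz
      · simp; positivity
      have hz' : 0 < ‖z‖ := norm_pos_iff.2 hz
      rw [norm_mul, norm_mul, norm_smul, Real.norm_of_nonneg (Real.rpow_nonneg (norm_nonneg z) _),
        Real.norm_of_nonneg (Real.rpow_nonneg (norm_nonneg z) _)]
      calc ‖z‖ ^ (-(d:ℝ)) * (‖inner ℝ z v‖ * ‖h z‖) ≤ ‖z‖ ^ (-(d:ℝ)) * ((‖z‖ * ‖v‖) * ‖h z‖) := by
            gcongr; exact norm_inner_le_norm _ _
        _ = ‖v‖ * ((‖z‖ ^ (-(d:ℝ)) * ‖z‖ ^ (1:ℝ)) * ‖h z‖) := by rw [Real.rpow_one]; ring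
        _ = _ := by rw [← Real.rpow_add hz']; ring_nf
  refine ⟨I1, I2, ?_⟩
  have e1 : 2 * ((2 - (d:ℝ)) / 2) = 2 - d := by ring
  have e2 : 2 * (-(d:ℝ) / 2) = -d := by ring
  have t1 := np_tendsto d (by omega) ((2 - (d:ℝ)) / 2) (by linarith) _ hcont (by rw [e1]; exact I1)
  have t2 := np_tendsto d (by omega) (-(d:ℝ) / 2) (by linarith) (fun z => inner ℝ z v * h z)
    (by have := hh.continuous; fun_prop) (by rw [e2]; exact I2)
  rw [e1] at t1
  rw [e2] at t2
  refine tendsto_nhds_unique t1 ((t2.const_mul ((d:ℝ) - 2)).congr' ?_)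
  filter_upwards [self_mem_nhdsWithin] with ε hε
  rw [np_ibp_eps d ε hε h hh hc v]
  simp only [mul_assoc]

lemma np_laplace (d : ℕ) (hd : 3 ≤ d) (g : EuclideanSpace ℝ (Fin d) → ℝ)
    (hg : ContDiff ℝ 2 g) (hc : HasCompactSupport g) :
    ∑ i : Fin d, ∫ z, ‖z‖ ^ (2 - (d:ℝ)) *
      fderiv ℝ (fun y => fderiv ℝ g y (EuclideanSpace.single i 1)) z (EuclideanSpace.single i 1)
      = (d - 2) * ((d * volume.real (ball (0 : EuclideanSpace ℝ (Fin d)) 1)) * (- g 0)) := by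
  have key : ∀ i : Fin d, ContDiff ℝ 1 (fun y => fderiv ℝ g y (EuclideanSpace.single i 1)) := fun i =>
    (hg.fderiv_right (m := 1) (by norm_num)).clm_apply contDiff_const
  have kc : ∀ i : Fin d, HasCompactSupport (fun y => fderiv ℝ g y (EuclideanSpace.single i 1)) :=
    fun i => hc.fderiv_apply ℝ _
  rw [← np_radial d (by omega) g (hg.of_le (by norm_num)) hc,
    Finset.sum_congr rfl fun i _ => (np_ibp d hd _ (key i) (kc i) (EuclideanSpace.single i 1)).2.2,
    ← Finset.mul_sum, ← integral_finsetSum _ fun i _ =>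
      (np_ibp d hd _ (key i) (kc i) (EuclideanSpace.single i 1)).2.1]
  congr 2
  ext z
  rw [← Finset.mul_sum]
  congr 1
  have hz : fderiv ℝ g z z = fderiv ℝ g z
      (∑ i, (EuclideanSpace.basisFun (Fin d) ℝ).repr z i • EuclideanSpace.basisFun (Fin d) ℝ i) := by
    rw [(EuclideanSpace.basisFun (Fin d) ℝ).sum_repr z]
  rw [hz]
  simp [map_sum, EuclideanSpace.inner_single_right]

lemma np_sphere (d : ℕ) (hd : 3 ≤ d) :
    (d * volume.real (ball (0 : EuclideanSpace ℝ (Fin d)) 1))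
      = 2 * Real.pi ^ ((d : ℝ) / 2) / Real.Gamma ((d : ℝ) / 2) := by
  have : Nonempty (Fin d) := ⟨⟨0, by omega⟩⟩
  have hd' : (3:ℝ) ≤ d := by exact_mod_cast hd
  have hG : 0 < Real.Gamma ((d:ℝ)/2) := Real.Gamma_pos_of_pos (by linarith)
  rw [measureReal_def, EuclideanSpace.volume_ball, Real.Gamma_add_one (by simp; linarith)]
  simp only [Fintype.card_fin, ENNReal.ofReal_one, one_pow, one_mul]
  rw [ENNReal.toReal_ofReal (by positivity)]
  have : √Real.pi ^ d = Real.pi ^ ((d:ℝ)/2) := by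
    rw [Real.sqrt_eq_rpow, ← Real.rpow_natCast, ← Real.rpow_mul Real.pi_pos.le]
    congr 1; ring
  rw [this]
  field_simp

open scoped Convolution in
lemma np_conv_fderiv {d : ℕ} {K f : EuclideanSpace ℝ (Fin d) → ℝ} (hK : LocallyIntegrable K)
    (hf : ContDiff ℝ 1 f) (hc : HasCompactSupport f) (x v : EuclideanSpace ℝ (Fin d)) :
    fderiv ℝ (fun x => ∫ z, K z * f (x - z)) x v = ∫ z, K z * fderiv ℝ f (x - z) v := by
  have h := hc.hasFDerivAt_convolution_right (ContinuousLinearMap.mul ℝ ℝ) hK hf x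
  have e : (K ⋆[ContinuousLinearMap.mul ℝ ℝ] f) = fun x => ∫ z, K z * f (x - z) := by
    ext x; simp [convolution_def]
  rw [e] at h
  rw [h.fderiv, convolution_precompR_apply _ hK (hc.fderiv ℝ) (hf.continuous_fderiv one_ne_zero)]
  simp [convolution_def]

lemma np_fderiv_refl {d : ℕ} {h : EuclideanSpace ℝ (Fin d) → ℝ} (hh : Differentiable ℝ h)
    (x z v : EuclideanSpace ℝ (Fin d)) :
    fderiv ℝ (fun z => h (x - z)) z v = - fderiv ℝ h (x - z) v := by
  have h1 : HasFDerivAt (fun z : EuclideanSpace ℝ (Fin d) => x - z)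
      (-(ContinuousLinearMap.id ℝ (EuclideanSpace ℝ (Fin d)))) z := (hasFDerivAt_id z).const_sub x
  have h2 := (hh (x - z)).hasFDerivAt.comp z h1
  have h3 : fderiv ℝ (fun z => h (x - z)) z = _ := h2.fderiv
  rw [h3]
  simp

/-- For `d ≥ 3`, `Ω ⊆ ℝᵈ` bounded open and `f ∈ C_c^∞(Ω)`, the Newton potential
`u(x) = ∫_Ω (1/((d-2) s_d)) |x-y|^{2-d} f(y) dy` satisfies `-Δ u = f` on `Ω`. -/
theorem newton_potential_solves_poisson
    (d : ℕ) (hd : 3 ≤ d) (Ω : Set (EuclideanSpace ℝ (Fin d))) (hΩo : IsOpen Ω)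
    (hΩb : Bornology.IsBounded Ω) (f : EuclideanSpace ℝ (Fin d) → ℝ)
    (hf : ContDiff ℝ (⊤ : ℕ∞) f) (hfc : HasCompactSupport f) (hfs : tsupport f ⊆ Ω)
    (u : EuclideanSpace ℝ (Fin d) → ℝ)
    (hu : ∀ x, u x = ∫ y in Ω,
      (1 / (((d : ℝ) - 2) * (2 * Real.pi ^ ((d : ℝ) / 2) / Real.Gamma ((d : ℝ) / 2)))) *
        dist x y ^ ((2 : ℝ) - d) * f y) :
    ∀ x ∈ Ω,
      -(∑ i : Fin d,
          fderiv ℝ (fun y => fderiv ℝ u y (EuclideanSpace.single i 1)) x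
            (EuclideanSpace.single i 1)) = f x := by
  intro x _
  have hd' : (3:ℝ) ≤ d := by exact_mod_cast hd
  have hG : 0 < Real.Gamma ((d:ℝ)/2) := Real.Gamma_pos_of_pos (by linarith)
  have hS : 0 < 2 * Real.pi ^ ((d : ℝ) / 2) / Real.Gamma ((d : ℝ) / 2) := by
    have := Real.pi_pos
    positivity
  have hsph := np_sphere d hd
  generalize 2 * Real.pi ^ ((d : ℝ) / 2) / Real.Gamma ((d : ℝ) / 2) = S at *
  have hK : LocallyIntegrable
      (fun z : EuclideanSpace ℝ (Fin d) => (1 / (((d : ℝ) - 2) * S)) * ‖z‖ ^ (2 - (d:ℝ))) := by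
    have := (np_locInt d (by omega) (d - 2) (by linarith)).smul (1 / (((d : ℝ) - 2) * S))
    rw [neg_sub] at this
    exact this
  have hu' : u = fun x => ∫ z, ((1 / (((d : ℝ) - 2) * S)) * ‖z‖ ^ (2 - (d:ℝ))) * f (x - z) := by
    ext x
    rw [hu x, setIntegral_eq_integral_of_forall_compl_eq_zero, ← integral_sub_left_eq_self _ _ x]
    · simp only [sub_sub_cancel, dist_eq_norm]
    · intro y hy
      rw [image_eq_zero_of_notMem_tsupport fun h => hy (hfs h), mul_zero]
  have hf2 : ContDiff ℝ 2 f := contDiff_infty.1 hf 2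
  have hf1 : ContDiff ℝ 1 f := hf2.of_le (by norm_num)
  have k1 : ∀ i : Fin d, ContDiff ℝ 1 (fun y => fderiv ℝ f y (EuclideanSpace.single i 1)) := fun i =>
    (hf2.fderiv_right (m := 1) (by norm_num)).clm_apply contDiff_const
  have kc : ∀ i : Fin d, HasCompactSupport (fun y => fderiv ℝ f y (EuclideanSpace.single i 1)) :=
    fun i => hfc.fderiv_apply ℝ _
  have step : ∀ i : Fin d, fderiv ℝ (fun y => fderiv ℝ u y (EuclideanSpace.single i 1)) x
      (EuclideanSpace.single i 1) = (1 / (((d : ℝ) - 2) * S)) * ∫ z, ‖z‖ ^ (2 - (d:ℝ)) *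
        fderiv ℝ (fun y => fderiv ℝ (fun z => f (x - z)) y (EuclideanSpace.single i 1)) z
          (EuclideanSpace.single i 1) := by
    intro i
    have e1 : (fun y => fderiv ℝ u y (EuclideanSpace.single i 1)) = fun y =>
        ∫ z, ((1 / (((d : ℝ) - 2) * S)) * ‖z‖ ^ (2 - (d:ℝ))) *
          (fun y => fderiv ℝ f y (EuclideanSpace.single i 1)) (y - z) := by
      ext y
      rw [hu']
      exact np_conv_fderiv hK hf1 hfc y _
    rw [e1, np_conv_fderiv hK (k1 i) (kc i), ← integral_const_mul]
    congr 1
    ext z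
    have e2 : (fun y => fderiv ℝ (fun z => f (x - z)) y (EuclideanSpace.single i 1)) =
        fun y => -((fun y => fderiv ℝ f y (EuclideanSpace.single i 1)) (x - y)) := by
      ext y
      exact np_fderiv_refl (hf1.differentiable one_ne_zero) x y _
    rw [e2, fderiv_fun_neg, _root_.neg_apply,
      np_fderiv_refl ((k1 i).differentiable one_ne_zero), neg_neg, mul_assoc]
  rw [Finset.sum_congr rfl fun i _ => step i, ← Finset.mul_sum,
    np_laplace d hd (fun z => f (x - z)) (hf2.comp (contDiff_const.sub contDiff_id)) ?_, hsph]
  · have : (d:ℝ) - 2 ≠ 0 := by linarith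
    simp only [sub_zero]
    field_simp
  · exact hfc.comp_homeomorph (Homeomorph.subLeft x)
end

section
/- Let B ⊂ ℝ^d (d ≥ 3) be the ball centred at the origin with |B| = |Ω| for a bounded open set Ω ⊂ ℝ^d. Then the operator norm of the Newton potential satisfies ‖N_Ω‖ ≤ ‖N_B‖, i.e., the smallest characteristic number satisfies μ₁(B) ≤ μ₁(Ω). -/
open MeasureTheory Metric
open scoped ENNReal

namespace NewtonRFK

/-- A polarization: an isometric, measure preserving involution with a closed half space. -/
structure Pol (E : Type*) [NormedAddCommGroup E] [MeasureSpace E] where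
  σ : E → E
  H : Set E
  invol : ∀ x, σ (σ x) = x
  isom : ∀ x y, dist (σ x) (σ y) = dist x y
  mp : MeasurePreserving σ volume volume
  measH : MeasurableSet H
  outH : ∀ x, x ∉ H → σ x ∈ H
  inH : ∀ x, x ∈ H → σ x ∉ H ∨ σ x = x
  dist_le : ∀ x y, x ∈ H → y ∈ H → dist x y ≤ dist x (σ y)
  zeroH : (0 : E) ∈ H

theorem two_point (a a' b b' k k' : ℝ≥0∞) (hk : k' ≤ k) :
    k * (a * b) + k' * (a * b') + k' * (a' * b) + k * (a' * b') ≤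
      k * (max a a' * max b b') + k' * (max a a' * min b b')
        + k' * (min a a' * max b b') + k * (min a a' * min b b') := by
  obtain ⟨w, rfl⟩ := exists_add_of_le hk
  rcases le_total a a' with h1 | h1 <;> rcases le_total b b' with h2 | h2 <;>
    simp only [max_eq_left, max_eq_right, min_eq_left, min_eq_right, h1, h2] <;>
    obtain ⟨u, rfl⟩ := exists_add_of_le h1 <;>
    obtain ⟨v, rfl⟩ := exists_add_of_le h2
  · exact le_of_eq (by ring)
  · refine le_of_le_of_eq (le_self_add (b := w * u * v)) ?_
    ring
  · refine le_of_le_of_eq (le_self_add (b := w * u * v)) ?_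
    ring
  · exact le_of_eq (by ring)

namespace Pol

variable {E : Type*} [NormedAddCommGroup E] [MeasureSpace E] (P : Pol E)

open Classical in
/-- polarization of a function -/
noncomputable def pf (f : E → ℝ≥0∞) (x : E) : ℝ≥0∞ :=
  if x ∈ P.H then max (f x) (f (P.σ x)) else min (f x) (f (P.σ x))

/-- polarization of a set -/
def ps (A : Set E) : Set E :=
  {x | (x ∈ P.H ∧ (x ∈ A ∨ P.σ x ∈ A)) ∨ (x ∉ P.H ∧ x ∈ A ∧ P.σ x ∈ A)}

theorem pf_of_mem (f : E → ℝ≥0∞) {x : E} (hx : x ∈ P.H) :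
    P.pf f x = max (f x) (f (P.σ x)) := by simp [pf, hx]

theorem pf_σ_of_mem (f : E → ℝ≥0∞) {x : E} (hx : x ∈ P.H) :
    P.pf f (P.σ x) = min (f x) (f (P.σ x)) := by
  rcases P.inH x hx with h | h
  · simp [pf, h, P.invol, min_comm]
  · simp [pf, h, hx]

theorem measurable_pf {f : E → ℝ≥0∞} (hf : Measurable f) : Measurable (P.pf f) := by
  classical
  have h2 : Measurable fun x => f (P.σ x) := hf.comp P.mp.measurable
  exact Measurable.ite P.measH (hf.max h2) (hf.min h2)

theorem measurableSet_ps {A : Set E} (hA : MeasurableSet A) : MeasurableSet (P.ps A) := by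
  have h2 : MeasurableSet (P.σ ⁻¹' A) := P.mp.measurable hA
  exact (P.measH.inter (hA.union h2)).union (P.measH.compl.inter (hA.inter h2))

theorem pf_le {f : E → ℝ≥0∞} {M : ℝ≥0∞} (hf : ∀ x, f x ≤ M) (x : E) : P.pf f x ≤ M := by
  unfold pf
  split_ifs
  · exact max_le (hf _) (hf _)
  · exact (min_le_left _ _).trans (hf _)

theorem pf_eq_zero {f : E → ℝ≥0∞} {A : Set E} (hf : ∀ x, x ∉ A → f x = 0) (x : E)
    (hx : x ∉ P.ps A) : P.pf f x = 0 := by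
  simp only [ps, Set.mem_ofPred_eq, not_or, not_and] at hx
  unfold pf
  split_ifs with h
  · rw [hf _ (hx.1 h).1, hf _ (hx.1 h).2]; simp
  · by_cases hA : x ∈ A
    · rw [hf _ (hx.2 h hA)]; simp
    · rw [hf _ hA]; simp

theorem norm_le {x : E} (hx : x ∈ P.H) : ‖x‖ ≤ ‖P.σ x‖ := by
  have := P.dist_le 0 x P.zeroH hx
  simpa using this

theorem dbl {F : E → ℝ≥0∞} (hF : Measurable F) :
    2 * ∫⁻ x, F x = ∫⁻ x, (F x + F (P.σ x)) := by
  rw [lintegral_add_left hF, P.mp.lintegral_comp hF, two_mul]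

/-- From a pointwise inequality of symmetrized functions to integrals. -/
theorem lintegral_le {F G : E → ℝ≥0∞} (hF : Measurable F) (hG : Measurable G)
    (h : ∀ x ∈ P.H, F x + F (P.σ x) ≤ G x + G (P.σ x)) : ∫⁻ x, F x ≤ ∫⁻ x, G x := by
  have : 2 * ∫⁻ x, F x ≤ 2 * ∫⁻ x, G x := by
    rw [P.dbl hF, P.dbl hG]
    refine lintegral_mono fun x => ?_
    by_cases hx : x ∈ P.H
    · exact h x hx
    · have := h _ (P.outH x hx)
      rw [P.invol] at this
      simpa [add_comm] using this
  exact (ENNReal.mul_le_mul_iff_right (by simp) (by simp)).1 this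

theorem lintegral_pf_sq {f : E → ℝ≥0∞} (hf : Measurable f) :
    ∫⁻ x, P.pf f x ^ (2 : ℝ) ≤ ∫⁻ x, f x ^ (2 : ℝ) := by
  refine P.lintegral_le ((P.measurable_pf hf).pow_const _) (hf.pow_const _) fun x hx => ?_
  rw [P.pf_of_mem f hx, P.pf_σ_of_mem f hx]
  rcases le_total (f x) (f (P.σ x)) with h | h
  · rw [max_eq_right h, min_eq_left h, add_comm]
  · rw [max_eq_left h, min_eq_right h]

theorem lintegral_ps_le (A B G : Set E) (r : ℝ) (hB : ∀ x, x ∈ B ↔ ‖x‖ < r)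
    (hA : MeasurableSet A) (hBm : MeasurableSet B)
    (hG : G = {x | (x ∈ A ∧ x ∉ B) ∧ (P.σ x ∈ B ∧ P.σ x ∉ A)}) :
    volume (P.ps A \ B) + volume G ≤ volume (A \ B) := by
  classical
  have hps := P.measurableSet_ps hA
  have hGm : MeasurableSet G := by
    rw [hG]
    exact (hA.diff hBm).inter (P.mp.measurable (hBm.diff hA))
  have h1 : Measurable ((P.ps A \ B).indicator (1 : E → ℝ≥0∞)) :=
    measurable_one.indicator (hps.diff hBm)
  have h2 : Measurable (G.indicator (1 : E → ℝ≥0∞)) := measurable_one.indicator hGm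
  have h3 : Measurable ((A \ B).indicator (1 : E → ℝ≥0∞)) :=
    measurable_one.indicator (hA.diff hBm)
  rw [← lintegral_indicator_one (hps.diff hBm), ← lintegral_indicator_one hGm,
    ← lintegral_indicator_one (hA.diff hBm), ← lintegral_add_left h1]
  refine P.lintegral_le (h1.add h2) h3 fun x hx => ?_
  have hn := P.norm_le hx
  have hb : P.σ x ∈ B → x ∈ B := by
    rw [hB, hB]; exact fun h => lt_of_le_of_lt hn h
  subst hG
  clear hB hGm h1 h2 h3 hps hn
  simp only [Set.indicator_apply, Set.mem_sdiff, ps, Set.mem_ofPred_eq, P.invol, hx, true_and,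
    not_true_eq_false, false_and, or_false, Pi.one_apply]
  rcases P.inH x hx with h | h
  · by_cases hxA : x ∈ A <;> by_cases hsA : P.σ x ∈ A <;> by_cases hxB : x ∈ B <;>
      by_cases hsB : P.σ x ∈ B <;> simp_all
  · rw [h]
    by_cases hxA : x ∈ A <;> by_cases hxB : x ∈ B <;> simp_all

theorem volume_ps_le {A : Set E} (hA : MeasurableSet A) : volume (P.ps A) ≤ volume A := by
  have h := P.lintegral_ps_le A ∅ _ 0 (by simp) hA MeasurableSet.empty rfl
  simp only [Set.sdiff_empty] at h
  exact le_self_add.trans h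

theorem ps_subset {A : Set E} {R : ℝ} (hA : A ⊆ closedBall 0 R) : P.ps A ⊆ closedBall 0 R := by
  rintro x (⟨h1, h2 | h2⟩ | ⟨h1, h2, h3⟩)
  · exact hA h2
  · have := hA h2
    have h4 := P.norm_le h1
    simp only [mem_closedBall, dist_zero_right] at this ⊢
    linarith
  · exact hA h2

variable [OpensMeasurableSpace E] [SecondCountableTopology E] [SFinite (volume : Measure E)]

theorem dbl2 {F : E → E → ℝ≥0∞} (hF : Measurable (Function.uncurry F)) :
    2 * (2 * ∫⁻ x, ∫⁻ y, F x y) =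
      ∫⁻ x, ∫⁻ y, ((F x y + F x (P.σ y)) + (F (P.σ x) y + F (P.σ x) (P.σ y))) := by
  have hx : ∀ x, Measurable (F x) := fun x => hF.comp measurable_prodMk_left
  have h0 : Measurable fun x => ∫⁻ y, F x y := hF.lintegral_prod_right'
  rw [P.dbl h0, ← lintegral_const_mul']
  · refine lintegral_congr fun x => ?_
    rw [mul_add, P.dbl (hx x), P.dbl (hx (P.σ x)), ← lintegral_add_left]
    exact (hx x).add ((hx x).comp P.mp.measurable)
  · simp

theorem riesz_step {f g : E → ℝ≥0∞} (hf : Measurable f) (hg : Measurable g)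
    {κ : ℝ → ℝ≥0∞} (hκ : Antitone κ) :
    ∫⁻ x, ∫⁻ y, κ (dist x y) * (f x * g y) ≤
      ∫⁻ x, ∫⁻ y, κ (dist x y) * (P.pf f x * P.pf g y) := by
  have hκm : Measurable fun p : E × E => κ (dist p.1 p.2) :=
    hκ.measurable.comp (measurable_fst.dist measurable_snd)
  have hm : ∀ f g : E → ℝ≥0∞, Measurable f → Measurable g →
      Measurable (Function.uncurry fun x y => κ (dist x y) * (f x * g y)) := by
    intro f g hf hg
    exact hκm.mul ((hf.comp measurable_fst).mul (hg.comp measurable_snd))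
  have h2 := P.dbl2 (hm _ _ hf hg)
  have h3 := P.dbl2 (hm _ _ (P.measurable_pf hf) (P.measurable_pf hg))
  have d1 : ∀ x y, dist (P.σ x) y = dist x (P.σ y) := by
    intro x y
    rw [← P.isom (P.σ x) y, P.invol]
  have key : ∀ x ∈ P.H, ∀ y ∈ P.H,
      (κ (dist x y) * (f x * g y) + κ (dist x (P.σ y)) * (f x * g (P.σ y)))
        + (κ (dist (P.σ x) y) * (f (P.σ x) * g y)
          + κ (dist (P.σ x) (P.σ y)) * (f (P.σ x) * g (P.σ y))) ≤
      (κ (dist x y) * (P.pf f x * P.pf g y) + κ (dist x (P.σ y)) * (P.pf f x * P.pf g (P.σ y)))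
        + (κ (dist (P.σ x) y) * (P.pf f (P.σ x) * P.pf g y)
          + κ (dist (P.σ x) (P.σ y)) * (P.pf f (P.σ x) * P.pf g (P.σ y))) := by
    intro x hx y hy
    rw [P.isom, d1, P.pf_of_mem f hx, P.pf_of_mem g hy, P.pf_σ_of_mem f hx, P.pf_σ_of_mem g hy]
    have := two_point (f x) (f (P.σ x)) (g y) (g (P.σ y)) _ _ (hκ (P.dist_le x y hx hy))
    simpa only [add_assoc] using this
  have : 2 * (2 * ∫⁻ x, ∫⁻ y, κ (dist x y) * (f x * g y)) ≤
      2 * (2 * ∫⁻ x, ∫⁻ y, κ (dist x y) * (P.pf f x * P.pf g y)) := by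
    rw [h2, h3]
    refine lintegral_mono fun x => lintegral_mono fun y => ?_
    have hx' : x ∈ P.H ∨ P.σ x ∈ P.H := by
      by_cases h : x ∈ P.H
      · exact Or.inl h
      · exact Or.inr (P.outH x h)
    have hy' : y ∈ P.H ∨ P.σ y ∈ P.H := by
      by_cases h : y ∈ P.H
      · exact Or.inl h
      · exact Or.inr (P.outH y h)
    rcases hx' with hx | hx <;> rcases hy' with hy | hy <;> have := key _ hx _ hy <;>
      (try simp only [P.invol] at this) <;> refine le_of_eq_of_le ?_ (le_of_le_of_eq this ?_) <;> ring
  rw [ENNReal.mul_le_mul_iff_right (by simp) (by simp),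
    ENNReal.mul_le_mul_iff_right (by simp) (by simp)] at this
  exact this

end Pol

section Reflection

variable {d : ℕ}

/-- Affine reflection across the hyperplane `⟪x, θ⟫ = s`. -/
noncomputable def refl (θ : EuclideanSpace ℝ (Fin d)) (s : ℝ) (x : EuclideanSpace ℝ (Fin d)) :
    EuclideanSpace ℝ (Fin d) := x + (2 * (s - inner ℝ x θ)) • θ

theorem inner_refl {θ : EuclideanSpace ℝ (Fin d)} (hθ : ‖θ‖ = 1) (s : ℝ)
    (x : EuclideanSpace ℝ (Fin d)) : inner ℝ (refl θ s x) θ = 2 * s - inner ℝ x θ := by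
  simp only [refl, inner_add_left, inner_smul_left, real_inner_self_eq_norm_sq, hθ]
  simp
  ring

theorem refl_refl {θ : EuclideanSpace ℝ (Fin d)} (hθ : ‖θ‖ = 1) (s : ℝ)
    (x : EuclideanSpace ℝ (Fin d)) : refl θ s (refl θ s x) = x := by
  have h := inner_refl hθ s x
  have h2 : refl θ s (refl θ s x) =
      refl θ s x + (2 * (s - inner ℝ (refl θ s x) θ)) • θ := rfl
  rw [h2, h, refl, add_assoc, ← add_smul]
  have h3 : 2 * (s - inner ℝ x θ) + 2 * (s - (2 * s - inner ℝ x θ)) = 0 := by ring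
  rw [h3, zero_smul, add_zero]

theorem refl_eq {θ : EuclideanSpace ℝ (Fin d)} (hθ : ‖θ‖ = 1) (s : ℝ)
    (x : EuclideanSpace ℝ (Fin d)) :
    refl θ s x = (ℝ ∙ θ)ᗮ.reflection x + (2 * s) • θ := by
  rw [Submodule.reflection_orthogonal_apply, Submodule.reflection_singleton_apply, hθ, refl,
    real_inner_comm]
  simp only [RCLike.ofReal_one, one_pow, div_one, two_smul, mul_sub, sub_smul, two_mul, add_smul]
  abel

theorem norm_sub_refl_sq {θ : EuclideanSpace ℝ (Fin d)} (hθ : ‖θ‖ = 1) (s : ℝ)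
    (x y : EuclideanSpace ℝ (Fin d)) :
    dist x (refl θ s y) ^ 2 = dist x y ^ 2 +
      4 * ((inner ℝ y θ - s) * (inner ℝ x θ - s)) := by
  rw [dist_eq_norm, dist_eq_norm, refl, ← sub_sub, norm_sub_sq_real, inner_smul_right,
    norm_smul, hθ, inner_sub_left, mul_one, Real.norm_eq_abs, sq_abs]
  ring

theorem measurePreserving_refl {θ : EuclideanSpace ℝ (Fin d)} (hθ : ‖θ‖ = 1) (s : ℝ) :
    MeasurePreserving (refl θ s) volume volume := by
  have h1 := ((ℝ ∙ θ)ᗮ.reflection).measurePreserving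
  have h2 := measurePreserving_add_right (volume : Measure (EuclideanSpace ℝ (Fin d)))
    ((2 * s) • θ)
  have := h2.comp h1
  have he : refl θ s = (fun x => x + (2 * s) • θ) ∘ ⇑(ℝ ∙ θ)ᗮ.reflection := by
    funext x
    exact refl_eq hθ s x
  rw [he]
  exact this

theorem dist_refl_refl {θ : EuclideanSpace ℝ (Fin d)} (hθ : ‖θ‖ = 1) (s : ℝ)
    (x y : EuclideanSpace ℝ (Fin d)) : dist (refl θ s x) (refl θ s y) = dist x y := by
  rw [refl_eq hθ, refl_eq hθ, dist_add_right, LinearIsometryEquiv.dist_map]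

/-- The polarization with respect to a half space containing the origin. -/
noncomputable def pol {θ : EuclideanSpace ℝ (Fin d)} (hθ : ‖θ‖ = 1) {s : ℝ} (hs : s ≤ 0) :
    Pol (EuclideanSpace ℝ (Fin d)) where
  σ := refl θ s
  H := {x | s ≤ inner ℝ x θ}
  invol := refl_refl hθ s
  isom := dist_refl_refl hθ s
  mp := measurePreserving_refl hθ s
  measH := by
    apply measurableSet_le measurable_const
    fun_prop
  outH x hx := by
    simp only [Set.mem_ofPred_eq, not_le] at hx ⊢
    rw [inner_refl hθ]; linarith
  inH x hx := by
    simp only [Set.mem_ofPred_eq, not_le] at hx ⊢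
    rw [inner_refl hθ]
    rcases hx.lt_or_eq with h | h
    · left; linarith
    · right; simp [refl, ← h]
  dist_le x y hx hy := by
    simp only [Set.mem_ofPred_eq] at hx hy
    have h := norm_sub_refl_sq hθ s x y
    have : 0 ≤ (inner ℝ y θ - s) * (inner ℝ x θ - s) :=
      mul_nonneg (sub_nonneg.2 hy) (sub_nonneg.2 hx)
    exact abs_le_of_sq_le_sq' (by linarith) dist_nonneg |>.2
  zeroH := by simpa using hs

theorem exists_pol {θ : EuclideanSpace ℝ (Fin d)} (hθ : ‖θ‖ = 1) (s : ℝ) :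
    ∃ P : Pol (EuclideanSpace ℝ (Fin d)), P.σ = refl θ s := by
  rcases le_total s 0 with hs | hs
  · exact ⟨pol hθ hs, rfl⟩
  · refine ⟨pol (θ := -θ) (by simpa using hθ) (s := -s) (by linarith), ?_⟩
    ext1 x
    change refl (-θ) (-s) x = _
    simp only [refl, inner_neg_right, smul_neg, ← neg_smul]
    congr 2
    ring

theorem lintegral_polar (F : EuclideanSpace ℝ (Fin d) → ℝ≥0∞) (hd : 0 < d) (hF : Measurable F) :
    ∫⁻ z, F z = ∫⁻ θ, ∫⁻ t in Set.Ioi (0 : ℝ), ENNReal.ofReal (t ^ (d - 1)) *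
      F (t • (θ : EuclideanSpace ℝ (Fin d))) ∂(volume : Measure ℝ)
        ∂(volume : Measure (EuclideanSpace ℝ (Fin d))).toSphere := by
  have : Nonempty (Fin d) := ⟨⟨0, hd⟩⟩
  have hmp := (volume : Measure (EuclideanSpace ℝ (Fin d))).measurePreserving_homeomorphUnitSphereProd
  have hG : Measurable fun p : sphere (0 : EuclideanSpace ℝ (Fin d)) 1 × Set.Ioi (0 : ℝ) =>
      F (p.2.1 • p.1.1) := by
    apply hF.comp
    fun_prop
  have h1 := hmp.lintegral_comp hG
  rw [lintegral_prod _ hG.aemeasurable] at h1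
  have h2 : ∫⁻ z, F z = ∫⁻ z in ({0}ᶜ : Set (EuclideanSpace ℝ (Fin d))), F z := by
    rw [restrict_compl_singleton]
  rw [h2, ← lintegral_subtype_comap (measurableSet_singleton _).compl]
  refine Eq.trans ?_ (h1.trans ?_)
  · refine lintegral_congr fun z => ?_
    have hz : ‖(z : EuclideanSpace ℝ (Fin d))‖ ≠ 0 := norm_ne_zero_iff.2 z.2
    simp [smul_smul, hz]
  · refine lintegral_congr fun θ => ?_
    rw [Measure.volumeIoiPow, lintegral_withDensity_eq_lintegral_mul, 
      ← lintegral_subtype_comap measurableSet_Ioi]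
    · simp
    · fun_prop
    · apply hF.comp
      fun_prop

theorem lintegral_affine (h : ℝ → ℝ≥0∞) (hh : Measurable h) (a : ℝ) :
    ∫⁻ t, h t = 2 * ∫⁻ s, h (2 * (s - a)) := by
  rw [lintegral_sub_right_eq_self (fun s => h (2 * s)) a]
  have := Real.smul_map_volume_mul_left (a := 2) (by norm_num)
  conv_lhs => rw [← this]
  rw [lintegral_smul_measure, lintegral_map hh (by fun_prop)]
  simp

theorem gain_aux (hd : 0 < d) (R : ℝ) (F : Set (EuclideanSpace ℝ (Fin d)))
    (hFm : MeasurableSet F) (hF : F ⊆ closedBall 0 R) (x : EuclideanSpace ℝ (Fin d))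
    (hx : ‖x‖ ≤ R) :
    volume F ≤ ENNReal.ofReal ((2 * R) ^ (d - 1)) * 2 *
      ∫⁻ θ, ∫⁻ s in Set.Icc (-R) R, F.indicator 1 (refl (θ : EuclideanSpace ℝ (Fin d)) s x)
        ∂(volume : Measure ℝ) ∂(volume : Measure (EuclideanSpace ℝ (Fin d))).toSphere := by
  have hm : Measurable (F.indicator (1 : EuclideanSpace ℝ (Fin d) → ℝ≥0∞)) :=
    measurable_one.indicator hFm
  rw [← lintegral_indicator_one hFm, ← lintegral_add_left_eq_self _ x, lintegral_polar _ hd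
    (by exact hm.comp (by fun_prop)), ← lintegral_const_mul' _ _ (by finiteness)]
  refine lintegral_mono fun θ => ?_
  have hθ : ‖(θ : EuclideanSpace ℝ (Fin d))‖ = 1 := by simpa using θ.2
  calc _ ≤ ∫⁻ t in Set.Ioi (0 : ℝ), ENNReal.ofReal ((2 * R) ^ (d - 1)) *
      F.indicator 1 (x + t • (θ : EuclideanSpace ℝ (Fin d))) := by
        refine setLIntegral_mono' measurableSet_Ioi fun t ht => ?_
        by_cases h : x + t • (θ : EuclideanSpace ℝ (Fin d)) ∈ F
        · have h1 := hF h
          rw [mem_closedBall, dist_zero_right] at h1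
          have h2 : ‖t • (θ : EuclideanSpace ℝ (Fin d))‖ = t := by
            rw [norm_smul, hθ, mul_one, Real.norm_eq_abs, abs_of_pos ht]
          have h3 : t ≤ 2 * R := by
            have := norm_sub_le (x + t • (θ : EuclideanSpace ℝ (Fin d))) x
            rw [add_sub_cancel_left, h2] at this
            linarith
          gcongr
          exact le_of_lt ht
        · simp [h]
    _ ≤ ENNReal.ofReal ((2 * R) ^ (d - 1)) *
      ∫⁻ t : ℝ, F.indicator 1 (x + t • (θ : EuclideanSpace ℝ (Fin d))) := by
        rw [lintegral_const_mul' _ _ (by finiteness)]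
        gcongr
        exact Measure.restrict_le_self
    _ ≤ _ := by
        rw [lintegral_affine _ (by exact hm.comp (by fun_prop))
          (inner ℝ x (θ : EuclideanSpace ℝ (Fin d))), ← mul_assoc]
        refine mul_le_mul_right ?_ _
        rw [← lintegral_indicator measurableSet_Icc]
        refine lintegral_mono fun s => ?_
        by_cases h : refl (θ : EuclideanSpace ℝ (Fin d)) s x ∈ F
        · have hs : s ∈ Set.Icc (-R) R := by
            have h1 := hF h
            rw [mem_closedBall, dist_zero_right] at h1
            have h2 := inner_refl hθ s x
            have h3 := abs_real_inner_le_norm x (θ : EuclideanSpace ℝ (Fin d))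
            have h4 := abs_real_inner_le_norm (refl (θ : EuclideanSpace ℝ (Fin d)) s x)
              (θ : EuclideanSpace ℝ (Fin d))
            rw [hθ, mul_one, abs_le] at h3 h4
            constructor <;> linarith
          rw [Set.indicator_of_mem hs]
          rfl
        · have : F.indicator (1 : EuclideanSpace ℝ (Fin d) → ℝ≥0∞)
              (x + (2 * (s - inner ℝ x (θ : EuclideanSpace ℝ (Fin d)))) •
                (θ : EuclideanSpace ℝ (Fin d))) = 0 := Set.indicator_of_notMem h _
          rw [this]
          exact zero_le

/-- Averaging over all reflections. -/
theorem gain (hd : 0 < d) (R : ℝ) : ∃ K : ℝ≥0∞, K ≠ ⊤ ∧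
    ∀ (A F : Set (EuclideanSpace ℝ (Fin d))) (c : ℝ≥0∞), MeasurableSet A → MeasurableSet F →
      A ⊆ closedBall 0 R → F ⊆ closedBall 0 R →
      (∀ (θ : EuclideanSpace ℝ (Fin d)) (s : ℝ), ‖θ‖ = 1 →
        volume (A ∩ refl θ s ⁻¹' F) ≤ c) → volume A * volume F ≤ K * c := by
  refine ⟨ENNReal.ofReal ((2 * R) ^ (d - 1)) * 2 * (volume (Set.Icc (-R) R) *
    (volume : Measure (EuclideanSpace ℝ (Fin d))).toSphere Set.univ), 
    ENNReal.mul_ne_top (by finiteness) (ENNReal.mul_ne_top (by simp) (measure_ne_top _ _)), ?_⟩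
  intro A F c hA hF hAR hFR hc
  set S := (volume : Measure (EuclideanSpace ℝ (Fin d))).toSphere
  set C := ENNReal.ofReal ((2 * R) ^ (d - 1)) * 2
  have hCtop : C ≠ ⊤ := by finiteness
  have hm : Measurable (F.indicator (1 : EuclideanSpace ℝ (Fin d) → ℝ≥0∞)) :=
    measurable_one.indicator hF
  have hG : Measurable fun q : EuclideanSpace ℝ (Fin d) ×
      (sphere (0 : EuclideanSpace ℝ (Fin d)) 1 × ℝ) =>
      F.indicator (1 : EuclideanSpace ℝ (Fin d) → ℝ≥0∞) (refl q.2.1.1 q.2.2 q.1) := by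
    refine hm.comp ?_
    unfold refl
    fun_prop
  calc volume A * volume F = ∫⁻ x in A, volume F := by
        rw [setLIntegral_const, mul_comm]
    _ ≤ ∫⁻ x in A, C * ∫⁻ p, F.indicator 1 (refl p.1.1 p.2 x)
          ∂(S.prod (volume.restrict (Set.Icc (-R) R))) := by
        refine setLIntegral_mono' hA fun x hx => ?_
        rw [lintegral_prod]
        · exact gain_aux hd R F hF hFR x (by simpa using hAR hx)
        · exact (hG.comp measurable_prodMk_left).aemeasurable
    _ = C * ∫⁻ p, (∫⁻ x in A, F.indicator 1 (refl p.1.1 p.2 x))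
          ∂(S.prod (volume.restrict (Set.Icc (-R) R))) := by
        rw [lintegral_const_mul' _ _ hCtop, lintegral_lintegral_swap]
        exact hG.aemeasurable
    _ ≤ C * ∫⁻ p, c ∂(S.prod (volume.restrict (Set.Icc (-R) R))) := by
        gcongr with p
        have hθ : ‖(p.1 : EuclideanSpace ℝ (Fin d))‖ = 1 := by simpa using p.1.2
        refine le_trans (le_of_eq ?_) (hc p.1.1 p.2 hθ)
        have hpre : MeasurableSet (refl p.1.1 p.2 ⁻¹' F) :=
          (measurePreserving_refl hθ p.2).measurable hF
        rw [Set.inter_comm, ← Measure.restrict_apply hpre, ← lintegral_indicator_one hpre]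
        rfl
    _ = _ := by
        rw [lintegral_const, ← Set.univ_prod_univ, Measure.prod_prod]
        simp only [Measure.restrict_apply_univ]
        ring

end Reflection

section Approx

variable {d : ℕ}

/-- Admissible triples. -/
structure Adm (M : ℝ≥0∞) (R : ℝ) (V a b q : ℝ≥0∞) (κ : ℝ → ℝ≥0∞)
    (f g : EuclideanSpace ℝ (Fin d) → ℝ≥0∞) (A : Set (EuclideanSpace ℝ (Fin d))) : Prop where
  mf : Measurable f
  mg : Measurable g
  mA : MeasurableSet A
  f_le : ∀ x, f x ≤ M
  g_le : ∀ x, g x ≤ M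
  f_zero : ∀ x, x ∉ A → f x = 0
  g_zero : ∀ x, x ∉ A → g x = 0
  A_sub : A ⊆ closedBall 0 R
  A_vol : volume A ≤ V
  f_sq : ∫⁻ x, f x ^ (2 : ℝ) ≤ a
  g_sq : ∫⁻ x, g x ^ (2 : ℝ) ≤ b
  q_le : q ≤ ∫⁻ x, ∫⁻ y, κ (dist x y) * (f x * g y)

theorem Adm.pol {M : ℝ≥0∞} {R : ℝ} {V a b q : ℝ≥0∞} {κ : ℝ → ℝ≥0∞} (hκ : Antitone κ)
    {f g : EuclideanSpace ℝ (Fin d) → ℝ≥0∞} {A : Set (EuclideanSpace ℝ (Fin d))}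
    (h : Adm M R V a b q κ f g A) (P : Pol (EuclideanSpace ℝ (Fin d))) :
    Adm M R V a b q κ (P.pf f) (P.pf g) (P.ps A) where
  mf := P.measurable_pf h.mf
  mg := P.measurable_pf h.mg
  mA := P.measurableSet_ps h.mA
  f_le := P.pf_le h.f_le
  g_le := P.pf_le h.g_le
  f_zero := P.pf_eq_zero h.f_zero
  g_zero := P.pf_eq_zero h.g_zero
  A_sub := P.ps_subset h.A_sub
  A_vol := (P.volume_ps_le h.mA).trans h.A_vol
  f_sq := (P.lintegral_pf_sq h.mf).trans h.f_sq
  g_sq := (P.lintegral_pf_sq h.mg).trans h.g_sq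
  q_le := h.q_le.trans (P.riesz_step h.mf h.mg hκ)

theorem Adm.approx (hd : 0 < d) {M : ℝ≥0∞} {R r : ℝ} {a b q : ℝ≥0∞} {κ : ℝ → ℝ≥0∞}
    (hκ : Antitone κ) (hrR : r ≤ R)
    {f₀ g₀ : EuclideanSpace ℝ (Fin d) → ℝ≥0∞} {A₀ : Set (EuclideanSpace ℝ (Fin d))}
    (h₀ : Adm M R (volume (ball (0 : EuclideanSpace ℝ (Fin d)) r)) a b q κ f₀ g₀ A₀)
    {ε : ℝ≥0∞} (hε : 0 < ε) :
    ∃ (f g : EuclideanSpace ℝ (Fin d) → ℝ≥0∞) (A : Set (EuclideanSpace ℝ (Fin d))),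
      Adm M R (volume (ball (0 : EuclideanSpace ℝ (Fin d)) r)) a b q κ f g A ∧
      volume (A \ ball 0 r) < ε := by
  set B := ball (0 : EuclideanSpace ℝ (Fin d)) r with hBdef
  have hB : ∀ x, x ∈ B ↔ ‖x‖ < r := fun x => by simp [hBdef]
  have hBm : MeasurableSet B := measurableSet_ball
  have hBfin : volume B ≠ ⊤ := measure_ball_lt_top.ne
  set S : Set ℝ≥0∞ := {v | ∃ (f g : EuclideanSpace ℝ (Fin d) → ℝ≥0∞) (A : Set (EuclideanSpace ℝ (Fin d))),
      Adm M R (volume B) a b q κ f g A ∧ v = volume (A \ B)}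
  have hI : sInf S = 0 := by
    by_contra hne
    set I := sInf S with hIdef
    have hItop : I ≠ ⊤ := by
      have h1 : I ≤ volume (A₀ \ B) := sInf_le ⟨f₀, g₀, A₀, h₀, rfl⟩
      have h2 : volume (A₀ \ B) ≤ volume B := (measure_mono Set.sdiff_subset).trans h₀.A_vol
      exact ((h1.trans h2).trans_lt hBfin.lt_top).ne
    obtain ⟨K, hK, hgain⟩ := gain hd R
    obtain ⟨c, hc0, hctop, hc⟩ : ∃ c : ℝ≥0∞, c ≠ 0 ∧ c ≠ ⊤ ∧ K * c < I * I := by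
      have hII : 0 < I * I := ENNReal.mul_pos hne hne
      obtain ⟨c, hc0, hc⟩ := ENNReal.exists_nnreal_pos_mul_lt hK hII.ne'
      exact ⟨c, by simpa using hc0.ne', by simp, by simpa [mul_comm] using hc⟩
    have hlt : I < I + c := ENNReal.lt_add_right hItop hc0
    obtain ⟨v, ⟨f, g, A, hA, rfl⟩, hv⟩ := sInf_lt_iff.1 hlt
    have h1 : I ≤ volume (A \ B) := sInf_le ⟨f, g, A, hA, rfl⟩
    have hAtop : volume A ≠ ⊤ := (hA.A_vol.trans_lt hBfin.lt_top).ne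
    have h2 : volume (A \ B) ≤ volume (B \ A) := by
      have e1 := measure_inter_add_sdiff (μ := volume) A hBm
      have e2 := measure_inter_add_sdiff (μ := volume) B hA.mA
      have e3 := hA.A_vol
      rw [← e1, ← e2, Set.inter_comm B A] at e3
      have hf : volume (A ∩ B) ≠ ⊤ := measure_ne_top_of_subset Set.inter_subset_left hAtop
      exact (ENNReal.add_le_add_iff_left hf).1 e3
    have h3 : K * c < volume (A \ B) * volume (B \ A) :=
      hc.trans_le (mul_le_mul' h1 (h1.trans h2))
    have h4 : ∃ (θ : EuclideanSpace ℝ (Fin d)) (s : ℝ), ‖θ‖ = 1 ∧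
        c < volume ((A \ B) ∩ refl θ s ⁻¹' (B \ A)) := by
      by_contra! hcon
      refine absurd (hgain (A \ B) (B \ A) c (hA.mA.diff hBm) (hBm.diff hA.mA)
        (Set.sdiff_subset.trans hA.A_sub) ?_ hcon) (not_le.2 h3)
      exact Set.sdiff_subset.trans (ball_subset_closedBall.trans (closedBall_subset_closedBall hrR))
    obtain ⟨θ, s, hθ, hG⟩ := h4
    obtain ⟨P, hP⟩ := exists_pol hθ s
    have h5 := P.lintegral_ps_le A B _ r hB hA.mA hBm rfl
    have h6 : I ≤ volume (P.ps A \ B) := sInf_le ⟨_, _, _, hA.pol hκ P, rfl⟩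
    rw [← hP] at hG
    have h7 : I + c ≤ volume (A \ B) := (add_le_add h6 hG.le).trans h5
    exact absurd (h7.trans_lt hv) (lt_irrefl _)
  rw [← hI] at hε
  obtain ⟨v, ⟨f, g, A, hA, rfl⟩, hv⟩ := sInf_lt_iff.1 hε
  exact ⟨f, g, A, hA, hv⟩

end Approx

section Kernel

variable {d : ℕ}

/-- The (extended) Newton kernel. -/
noncomputable def ker (c : ℝ) (d : ℕ) (t : ℝ) : ℝ≥0∞ :=
  ENNReal.ofReal c * ENNReal.ofReal t ^ ((2 : ℝ) - d)

theorem ker_antitone (c : ℝ) (hd : 3 ≤ d) : Antitone (ker c d) := by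
  intro s t hst
  have hd' : (3 : ℝ) ≤ d := by exact_mod_cast hd
  unfold ker
  gcongr ENNReal.ofReal c * ?_
  have h : (2 : ℝ) - d = -((d : ℝ) - 2) := by ring
  rw [h, ENNReal.rpow_neg, ENNReal.rpow_neg, ENNReal.inv_le_inv]
  exact ENNReal.rpow_le_rpow (ENNReal.ofReal_le_ofReal hst) (by linarith)

theorem ker_eq {c : ℝ} (hc : 0 ≤ c) {t : ℝ} (ht : 0 < t) :
    ker c d t = ENNReal.ofReal (c * t ^ ((2 : ℝ) - d)) := by
  rw [ker, ENNReal.ofReal_rpow_of_pos ht, ENNReal.ofReal_mul hc]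

theorem measurable_ker (c : ℝ) (hd : 3 ≤ d) :
    Measurable fun p : EuclideanSpace ℝ (Fin d) × EuclideanSpace ℝ (Fin d) =>
      ker c d (dist p.1 p.2) :=
  (ker_antitone c hd).measurable.comp (measurable_fst.dist measurable_snd)

theorem ker_integrable {c : ℝ} (hc : 0 ≤ c) (hd : 3 ≤ d) (R : ℝ) :
    ∃ C : ℝ≥0∞, C ≠ ⊤ ∧ ∀ x : EuclideanSpace ℝ (Fin d), ‖x‖ ≤ R →
      ∫⁻ y in closedBall 0 R, ker c d (dist x y) ≤ C := by
  have hm : Measurable (ker c d) := (ker_antitone c hd).measurable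
  refine ⟨ENNReal.ofReal (c * (2 * R)) * volume (Set.Ioc 0 (2 * R)) *
    (volume : Measure (EuclideanSpace ℝ (Fin d))).toSphere Set.univ,
    ENNReal.mul_ne_top (ENNReal.mul_ne_top (by simp) measure_Ioc_lt_top.ne) (measure_ne_top _ _), ?_⟩
  intro x hx
  rw [← lintegral_indicator measurableSet_closedBall, ← lintegral_add_left_eq_self _ x,
    lintegral_polar _ (by omega)]
  · rw [← lintegral_const]
    refine lintegral_mono fun θ => ?_
    have hθ : ‖(θ : EuclideanSpace ℝ (Fin d))‖ = 1 := by simp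
    rw [← setLIntegral_const, ← lintegral_indicator measurableSet_Ioc,
      ← lintegral_indicator measurableSet_Ioi]
    refine lintegral_mono fun t => ?_
    by_cases ht : 0 < t
    swap
    · rw [Set.indicator_of_notMem (by simpa using ht)]
      exact zero_le
    rw [Set.indicator_of_mem (by simpa using ht)]
    by_cases h : x + t • (θ : EuclideanSpace ℝ (Fin d)) ∈ closedBall 0 R
    swap
    · rw [Set.indicator_of_notMem h, mul_zero]
      exact zero_le
    have h2 : ‖t • (θ : EuclideanSpace ℝ (Fin d))‖ = t := by
      rw [norm_smul, hθ, mul_one, Real.norm_eq_abs, abs_of_pos ht]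
    have h3 : t ≤ 2 * R := by
      rw [mem_closedBall, dist_zero_right] at h
      have := norm_sub_le (x + t • (θ : EuclideanSpace ℝ (Fin d))) x
      rw [add_sub_cancel_left, h2] at this
      linarith
    rw [Set.indicator_of_mem h, Set.indicator_of_mem (Set.mem_Ioc.2 ⟨ht, h3⟩), dist_self_add_right, h2,
      ker_eq hc ht, ← ENNReal.ofReal_mul (by positivity)]
    apply ENNReal.ofReal_le_ofReal
    have h4 : t ^ (d - 1) * (c * t ^ ((2 : ℝ) - d)) = c * t := by
      rw [mul_left_comm, ← Real.rpow_natCast, ← Real.rpow_add ht,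
        Nat.cast_sub (by omega : 1 ≤ d)]
      norm_num
    rw [h4]
    gcongr
  · refine Measurable.comp (g := (closedBall (0 : EuclideanSpace ℝ (Fin d)) R).indicator
      fun y => ker c d (dist x y)) ?_ (by fun_prop)
    exact (hm.comp (by fun_prop)).indicator measurableSet_closedBall

/-- Removing the parts outside of `B`. -/
theorem split_bound {c : ℝ} (hd : 3 ≤ d) {R r : ℝ} (hrR : r ≤ R) {C M : ℝ≥0∞}
    (hC : ∀ x : EuclideanSpace ℝ (Fin d), ‖x‖ ≤ R →
      ∫⁻ y in closedBall 0 R, ker c d (dist x y) ≤ C)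
    {f g : EuclideanSpace ℝ (Fin d) → ℝ≥0∞} {A : Set (EuclideanSpace ℝ (Fin d))}
    (mf : Measurable f) (mg : Measurable g) (mA : MeasurableSet A)
    (f_le : ∀ x, f x ≤ M) (g_le : ∀ x, g x ≤ M)
    (f_zero : ∀ x, x ∉ A → f x = 0) (g_zero : ∀ x, x ∉ A → g x = 0)
    (hA : A ⊆ closedBall 0 R) :
    ∫⁻ x, ∫⁻ y, ker c d (dist x y) * (f x * g y) ≤
      (∫⁻ x in ball 0 r, f x * ∫⁻ y in ball 0 r, ker c d (dist x y) * g y) +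
        2 * (M * M * C) * volume (A \ ball 0 r) := by
  set B := ball (0 : EuclideanSpace ℝ (Fin d)) r
  set D := closedBall (0 : EuclideanSpace ℝ (Fin d)) R
  have hBm : MeasurableSet B := measurableSet_ball
  have hDm : MeasurableSet D := measurableSet_closedBall
  have hk := measurable_ker (d := d) c hd
  have mAB : MeasurableSet (A \ B) := mA.diff hBm
  have m1 : Measurable ((A \ B).indicator (1 : EuclideanSpace ℝ (Fin d) → ℝ≥0∞)) :=
    measurable_one.indicator mAB
  have mD : Measurable (D.indicator (1 : EuclideanSpace ℝ (Fin d) → ℝ≥0∞)) :=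
    measurable_one.indicator hDm
  have mfB := mf.indicator hBm
  have mgB := mg.indicator hBm
  -- generic bound
  have gen : ∀ F G : EuclideanSpace ℝ (Fin d) → ℝ≥0∞, Measurable F → Measurable G →
      Measurable fun p : EuclideanSpace ℝ (Fin d) × EuclideanSpace ℝ (Fin d) =>
        ker c d (dist p.1 p.2) * (F p.1 * G p.2) := fun F G hF hG =>
    hk.mul ((hF.comp measurable_fst).mul (hG.comp measurable_snd))
  have bd : ∫⁻ x, ∫⁻ y, ker c d (dist x y) * ((A \ B).indicator 1 x * D.indicator 1 y) ≤
      C * volume (A \ B) := by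
    calc _ = ∫⁻ x in A \ B, ∫⁻ y in D, ker c d (dist x y) := by
          rw [← lintegral_indicator mAB]
          refine lintegral_congr fun x => ?_
          by_cases hx : x ∈ A \ B
          · simp only [Set.indicator_of_mem hx, Pi.one_apply, one_mul]
            rw [← lintegral_indicator hDm]
            refine lintegral_congr fun y => ?_
            by_cases hy : y ∈ D <;> simp [hy]
          · simp only [Set.indicator_of_notMem hx, zero_mul, mul_zero, lintegral_zero]
      _ ≤ ∫⁻ x in A \ B, C := setLIntegral_mono' mAB fun x hx => hC x (mem_closedBall_zero_iff.1 (hA hx.1))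
      _ = _ := by rw [setLIntegral_const]
  have bd2 : ∫⁻ x, ∫⁻ y, ker c d (dist x y) * (D.indicator 1 x * (A \ B).indicator 1 y) ≤
      C * volume (A \ B) := by
    rw [lintegral_lintegral_swap (gen _ _ mD m1).aemeasurable]
    refine le_trans (le_of_eq ?_) bd
    refine lintegral_congr fun x => lintegral_congr fun y => ?_
    rw [dist_comm, mul_comm (D.indicator _ _)]
  have main : ∫⁻ x, ∫⁻ y, ker c d (dist x y) * (B.indicator f x * B.indicator g y) =
      ∫⁻ x in B, f x * ∫⁻ y in B, ker c d (dist x y) * g y := by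
    rw [← lintegral_indicator hBm]
    refine lintegral_congr fun x => ?_
    by_cases hx : x ∈ B
    · simp only [Set.indicator_of_mem hx]
      rw [← lintegral_const_mul _ (by
        exact (hk.comp measurable_prodMk_left).mul mg), ← lintegral_indicator hBm]
      refine lintegral_congr fun y => ?_
      by_cases hy : y ∈ B
      · simp only [Set.indicator_of_mem hy]
        ring
      · simp [hy]
    · simp only [Set.indicator_of_notMem hx, zero_mul, mul_zero, lintegral_zero]
  have pw : ∀ x y, f x * g y ≤ B.indicator f x * B.indicator g y +
      (M * M * ((A \ B).indicator 1 x * D.indicator 1 y) +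
        M * M * (D.indicator 1 x * (A \ B).indicator 1 y)) := by
    intro x y
    have hMM : f x * g y ≤ M * M := mul_le_mul' (f_le x) (g_le y)
    by_cases hxA : x ∈ A
    swap
    · simp [f_zero x hxA]
    by_cases hyA : y ∈ A
    swap
    · simp [g_zero y hyA]
    have hxD : x ∈ D := hA hxA
    have hyD : y ∈ D := hA hyA
    by_cases hxB : x ∈ B
    · by_cases hyB : y ∈ B
      · simp only [Set.indicator_of_mem hxB, Set.indicator_of_mem hyB]
        exact le_self_add
      · refine hMM.trans ?_
        simp [hxA, hyA, hxD, hyD, hxB, hyB]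
    · refine hMM.trans ?_
      simp [hxA, hyA, hxD, hyD, hxB]
  have hMC : ∀ F : EuclideanSpace ℝ (Fin d) → EuclideanSpace ℝ (Fin d) → ℝ≥0∞,
      Measurable (Function.uncurry F) → 
      ∫⁻ x, ∫⁻ y, M * M * F x y = M * M * ∫⁻ x, ∫⁻ y, F x y := by
    intro F hF
    have hF1 : ∀ x, Measurable (F x) := fun x => hF.comp measurable_prodMk_left
    have hF2 : Measurable fun x => ∫⁻ y, F x y := hF.lintegral_prod_right'
    rw [← lintegral_const_mul _ hF2]
    refine lintegral_congr fun x => ?_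
    rw [lintegral_const_mul _ (hF1 x)]
  have hadd : ∀ F G : EuclideanSpace ℝ (Fin d) → EuclideanSpace ℝ (Fin d) → ℝ≥0∞,
      Measurable (Function.uncurry F) → 
      ∫⁻ x, ∫⁻ y, (F x y + G x y) = (∫⁻ x, ∫⁻ y, F x y) + ∫⁻ x, ∫⁻ y, G x y := by
    intro F G hF
    have hF1 : ∀ x, Measurable (F x) := fun x => hF.comp measurable_prodMk_left
    have hF2 : Measurable fun x => ∫⁻ y, F x y := hF.lintegral_prod_right'
    rw [← lintegral_add_left hF2]
    refine lintegral_congr fun x => ?_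
    rw [lintegral_add_left (hF1 x)]
  calc _ ≤ ∫⁻ x, ∫⁻ y, (ker c d (dist x y) * (B.indicator f x * B.indicator g y) +
        (M * M * (ker c d (dist x y) * ((A \ B).indicator 1 x * D.indicator 1 y)) +
          M * M * (ker c d (dist x y) * (D.indicator 1 x * (A \ B).indicator 1 y)))) := by
        refine lintegral_mono fun x => lintegral_mono fun y => ?_
        refine (mul_le_mul_right (pw x y) _).trans (le_of_eq ?_)
        ring
    _ = _ := hadd _ _ (gen _ _ mfB mgB)
    _ ≤ _ := by
        rw [main]
        gcongr
        rw [hadd _ _ ((gen _ _ m1 mD).const_mul _), hMC (fun x y => ker c d (dist x y) * ((A \ B).indicator 1 x * D.indicator 1 y))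
            (gen _ _ m1 mD),
          hMC (fun x y => ker c d (dist x y) * (D.indicator 1 x * (A \ B).indicator 1 y))
            (gen _ _ mD m1)]
        refine (add_le_add (mul_le_mul_right bd _) (mul_le_mul_right bd2 _)).trans (le_of_eq ?_)
        ring

end Kernel

section Operator

variable {d : ℕ}

theorem enorm_Lp_eq {S : Set (EuclideanSpace ℝ (Fin d))} (u : Lp ℝ 2 (volume.restrict S)) :
    ‖u‖ₑ = (∫⁻ x in S, ‖u x‖ₑ ^ (2 : ℝ)) ^ (1 / 2 : ℝ) := by
  rw [Lp.enorm_def, eLpNorm_eq_lintegral_rpow_enorm_toReal (by norm_num) (by norm_num)]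
  simp

/-- The operator on the ball bounds the bilinear form for bounded functions. -/
theorem op_bound {c : ℝ} (hc : 0 ≤ c) (hd : 3 ≤ d) {r : ℝ}
    {B : Set (EuclideanSpace ℝ (Fin d))} (hBm : MeasurableSet B) (hBr : B ⊆ closedBall 0 r)
    (T : Lp ℝ 2 (volume.restrict B) →L[ℝ] Lp ℝ 2 (volume.restrict B))
    (hT : ∀ f, ∀ᵐ x ∂(volume.restrict B),
      T f x = ∫ y in B, c * dist x y ^ ((2 : ℝ) - d) * f y)
    {f g : EuclideanSpace ℝ (Fin d) → ℝ≥0∞} (mf : Measurable f) (mg : Measurable g)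
    {M : ℝ≥0∞} (hM : M ≠ ⊤) (g_le : ∀ x, g x ≤ M) :
    ∫⁻ x in B, f x * ∫⁻ y in B, ker c d (dist x y) * g y ≤
      ‖T‖ₑ * ((∫⁻ x, f x ^ (2 : ℝ)) ^ (1 / 2 : ℝ) * (∫⁻ x, g x ^ (2 : ℝ)) ^ (1 / 2 : ℝ)) := by
  have hne0 : Nonempty (Fin d) := ⟨⟨0, by omega⟩⟩
  have : IsFiniteMeasure (volume.restrict B) := ⟨by
    rw [Measure.restrict_apply_univ]
    exact (measure_mono hBr).trans_lt measure_closedBall_lt_top⟩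
  have hgtop : ∀ x, g x ≠ ⊤ := fun x => ((g_le x).trans_lt hM.lt_top).ne
  have hmem : MemLp (fun y => (g y).toReal) 2 (volume.restrict B) := by
    refine MemLp.of_bound mg.ennreal_toReal.aestronglyMeasurable M.toReal ?_
    refine Filter.Eventually.of_forall fun y => ?_
    rw [Real.norm_eq_abs, abs_of_nonneg ENNReal.toReal_nonneg]
    exact ENNReal.toReal_mono hM (g_le y)
  set u := hmem.toLp
  have hu := hmem.coeFn_toLp
  have hun : ‖u‖ₑ ≤ (∫⁻ x, g x ^ (2 : ℝ)) ^ (1 / 2 : ℝ) := by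
    rw [enorm_Lp_eq]
    gcongr ?_ ^ _
    refine le_trans (le_of_eq ?_) (setLIntegral_le_lintegral B _)
    refine lintegral_congr_ae ?_
    filter_upwards [hu] with x hx
    rw [hx, Real.enorm_eq_ofReal ENNReal.toReal_nonneg, ENNReal.ofReal_toReal (hgtop x)]
  obtain ⟨C, hCtop, hC⟩ := ker_integrable (d := d) hc hd r
  have hk := measurable_ker (d := d) c hd
  have key : ∀ᵐ x ∂(volume.restrict B), ∫⁻ y in B, ker c d (dist x y) * g y = ‖T u x‖ₑ := by
    filter_upwards [hT u, ae_restrict_mem hBm] with x hx hxB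
    have hne : ∀ᵐ y ∂(volume.restrict B), y ≠ x := ae_restrict_of_ae (by
      simp [ae_iff, measure_singleton])
    have e1 : ∫ y in B, c * dist x y ^ ((2 : ℝ) - d) * u y =
        ∫ y in B, c * dist x y ^ ((2 : ℝ) - d) * (g y).toReal := by
      refine integral_congr_ae ?_
      filter_upwards [hu] with y hy
      rw [hy]
    have hnn : ∀ y, 0 ≤ c * dist x y ^ ((2 : ℝ) - d) * (g y).toReal := fun y => by positivity
    have e2 : ∫⁻ y in B, ENNReal.ofReal (c * dist x y ^ ((2 : ℝ) - d) * (g y).toReal) =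
        ∫⁻ y in B, ker c d (dist x y) * g y := by
      refine lintegral_congr_ae ?_
      filter_upwards [hne] with y hy
      have hy' : 0 < dist x y := dist_pos.2 hy.symm
      rw [ker_eq hc hy', ENNReal.ofReal_mul (by positivity), ENNReal.ofReal_toReal (hgtop y)]
    have e3 : ∫⁻ y in B, ker c d (dist x y) * g y < ⊤ := by
      calc _ ≤ ∫⁻ y in B, ker c d (dist x y) * M := by gcongr; exact g_le _
        _ = (∫⁻ y in B, ker c d (dist x y)) * M := lintegral_mul_const' _ _ hM
        _ ≤ C * M := by
            gcongr
            refine (lintegral_mono_set hBr).trans (hC x ?_)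
            exact mem_closedBall_zero_iff.1 (hBr hxB)
        _ < ⊤ := ENNReal.mul_lt_top hCtop.lt_top hM.lt_top
    have hint : Integrable (fun y => c * dist x y ^ ((2 : ℝ) - d) * (g y).toReal)
        (volume.restrict B) := by
      refine ⟨?_, ?_⟩
      · apply Measurable.aestronglyMeasurable
        refine Measurable.mul ?_ mg.ennreal_toReal
        fun_prop
      · rw [hasFiniteIntegral_iff_ofReal (Filter.Eventually.of_forall hnn), e2]
        exact e3
    rw [hx, e1, Real.enorm_eq_ofReal (integral_nonneg hnn),
      ofReal_integral_eq_lintegral_ofReal hint (Filter.Eventually.of_forall hnn), e2]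
  calc _ = ∫⁻ x in B, (f * fun x => ‖T u x‖ₑ) x := by
        refine lintegral_congr_ae ?_
        filter_upwards [key] with x hx
        rw [hx]; rfl
    _ ≤ (∫⁻ x in B, f x ^ (2 : ℝ)) ^ (1 / 2 : ℝ) *
          (∫⁻ x in B, ‖T u x‖ₑ ^ (2 : ℝ)) ^ (1 / 2 : ℝ) :=
        ENNReal.lintegral_mul_le_Lp_mul_Lq _ Real.HolderConjugate.two_two mf.aemeasurable
          (Lp.stronglyMeasurable _).measurable.enorm.aemeasurable
    _ = (∫⁻ x in B, f x ^ (2 : ℝ)) ^ (1 / 2 : ℝ) * ‖T u‖ₑ := by rw [← enorm_Lp_eq]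
    _ ≤ (∫⁻ x, f x ^ (2 : ℝ)) ^ (1 / 2 : ℝ) *
          (‖T‖ₑ * (∫⁻ x, g x ^ (2 : ℝ)) ^ (1 / 2 : ℝ)) := by
        gcongr
        · exact Measure.restrict_le_self
        · exact (T.le_opENorm u).trans (by gcongr)
    _ = _ := by ring

/-- The Riesz type bound for bounded functions supported in `Ω`. -/
theorem riesz_bounded {c : ℝ} (hc : 0 ≤ c) (hd : 3 ≤ d) {r : ℝ}
    (T : Lp ℝ 2 (volume.restrict (ball (0 : EuclideanSpace ℝ (Fin d)) r)) →L[ℝ]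
          Lp ℝ 2 (volume.restrict (ball (0 : EuclideanSpace ℝ (Fin d)) r)))
    (hT : ∀ f, ∀ᵐ x ∂(volume.restrict (ball (0 : EuclideanSpace ℝ (Fin d)) r)),
      T f x = ∫ y in ball (0 : EuclideanSpace ℝ (Fin d)) r, c * dist x y ^ ((2 : ℝ) - d) * f y)
    {Ω : Set (EuclideanSpace ℝ (Fin d))} (hΩm : MeasurableSet Ω) (hΩb : Bornology.IsBounded Ω)
    (hvol : volume Ω ≤ volume (ball (0 : EuclideanSpace ℝ (Fin d)) r))
    {f g : EuclideanSpace ℝ (Fin d) → ℝ≥0∞} (mf : Measurable f) (mg : Measurable g)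
    {M : ℝ≥0∞} (hM : M ≠ ⊤) (f_le : ∀ x, f x ≤ M) (g_le : ∀ x, g x ≤ M)
    (f_zero : ∀ x, x ∉ Ω → f x = 0) (g_zero : ∀ x, x ∉ Ω → g x = 0) :
    ∫⁻ x, ∫⁻ y, ker c d (dist x y) * (f x * g y) ≤
      ‖T‖ₑ * ((∫⁻ x, f x ^ (2 : ℝ)) ^ (1 / 2 : ℝ) * (∫⁻ x, g x ^ (2 : ℝ)) ^ (1 / 2 : ℝ)) := by
  obtain ⟨R₀, hR₀⟩ := hΩb.subset_closedBall 0
  set R := max R₀ r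
  have hΩR : Ω ⊆ closedBall 0 R := hR₀.trans (closedBall_subset_closedBall (le_max_left _ _))
  have hrR : r ≤ R := le_max_right _ _
  obtain ⟨C, hCtop, hC⟩ := ker_integrable (d := d) hc hd R
  have h₀ : Adm M R (volume (ball (0 : EuclideanSpace ℝ (Fin d)) r)) (∫⁻ x, f x ^ (2 : ℝ))
      (∫⁻ x, g x ^ (2 : ℝ)) (∫⁻ x, ∫⁻ y, ker c d (dist x y) * (f x * g y)) (ker c d) f g Ω :=
    ⟨mf, mg, hΩm, f_le, g_le, f_zero, g_zero, hΩR, hvol, le_rfl, le_rfl, le_rfl⟩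
  set L := 2 * (M * M * C)
  have hL : L ≠ ⊤ := by finiteness
  refine ENNReal.le_of_forall_pos_le_add fun δ hδ _ => ?_
  have hδ' : (δ : ℝ≥0∞) ≠ 0 := by simpa using hδ.ne'
  obtain ⟨ε, hε0, hε⟩ := ENNReal.exists_nnreal_pos_mul_lt hL hδ'
  obtain ⟨f', g', A, hA, hAε⟩ := h₀.approx (by omega) (ker_antitone c hd) hrR
    (ε := (ε : ℝ≥0∞)) (by simpa using hε0)
  refine hA.q_le.trans ?_
  refine (split_bound hd hrR hC hA.mf hA.mg hA.mA hA.f_le hA.g_le hA.f_zero hA.g_zero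
    hA.A_sub).trans (add_le_add ?_ ?_)
  · refine (op_bound hc hd measurableSet_ball ball_subset_closedBall T hT hA.mf hA.mg hM hA.g_le).trans ?_
    gcongr _ * (?_ ^ _ * ?_ ^ _)
    · exact hA.f_sq
    · exact hA.g_sq
  · refine le_trans ?_ hε.le
    rw [mul_comm]
    gcongr

/-- Removing the boundedness assumption. -/
theorem riesz_finite {c : ℝ} (hc : 0 ≤ c) (hd : 3 ≤ d) {r : ℝ}
    (T : Lp ℝ 2 (volume.restrict (ball (0 : EuclideanSpace ℝ (Fin d)) r)) →L[ℝ]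
          Lp ℝ 2 (volume.restrict (ball (0 : EuclideanSpace ℝ (Fin d)) r)))
    (hT : ∀ f, ∀ᵐ x ∂(volume.restrict (ball (0 : EuclideanSpace ℝ (Fin d)) r)),
      T f x = ∫ y in ball (0 : EuclideanSpace ℝ (Fin d)) r, c * dist x y ^ ((2 : ℝ) - d) * f y)
    {Ω : Set (EuclideanSpace ℝ (Fin d))} (hΩm : MeasurableSet Ω) (hΩb : Bornology.IsBounded Ω)
    (hvol : volume Ω ≤ volume (ball (0 : EuclideanSpace ℝ (Fin d)) r))
    {f g : EuclideanSpace ℝ (Fin d) → ℝ≥0∞} (mf : Measurable f) (mg : Measurable g)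
    (f_fin : ∀ x, f x ≠ ⊤) (g_fin : ∀ x, g x ≠ ⊤)
    (f_zero : ∀ x, x ∉ Ω → f x = 0) (g_zero : ∀ x, x ∉ Ω → g x = 0) :
    ∫⁻ x, ∫⁻ y, ker c d (dist x y) * (f x * g y) ≤
      ‖T‖ₑ * ((∫⁻ x, f x ^ (2 : ℝ)) ^ (1 / 2 : ℝ) * (∫⁻ x, g x ^ (2 : ℝ)) ^ (1 / 2 : ℝ)) := by
  have hk := measurable_ker (d := d) c hd
  have gen : ∀ F G : EuclideanSpace ℝ (Fin d) → ℝ≥0∞, Measurable F → Measurable G →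
      Measurable fun p : EuclideanSpace ℝ (Fin d) × EuclideanSpace ℝ (Fin d) =>
        ker c d (dist p.1 p.2) * (F p.1 * G p.2) := fun F G hF hG =>
    hk.mul ((hF.comp measurable_fst).mul (hG.comp measurable_snd))
  have mfn : ∀ n : ℕ, Measurable fun x => min (f x) n := fun n => mf.min measurable_const
  have mgn : ∀ n : ℕ, Measurable fun x => min (g x) n := fun n => mg.min measurable_const
  have e := lintegral_prod (μ := volume) (ν := volume) _ (gen f g mf mg).aemeasurable
  rw [← e]
  calc _ ≤ ∫⁻ p : EuclideanSpace ℝ (Fin d) × EuclideanSpace ℝ (Fin d),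
        ⨆ n : ℕ, ker c d (dist p.1 p.2) * (min (f p.1) n * min (g p.2) n)
          ∂(volume.prod volume) := by
        refine lintegral_mono fun p => ?_
        obtain ⟨n, hn⟩ := ENNReal.exists_nat_gt (f_fin p.1)
        obtain ⟨m, hm⟩ := ENNReal.exists_nat_gt (g_fin p.2)
        refine le_iSup_of_le (max n m) (le_of_eq ?_)
        rw [min_eq_left, min_eq_left]
        · exact hm.le.trans (by exact_mod_cast le_max_right n m)
        · exact hn.le.trans (by exact_mod_cast le_max_left n m)
    _ = ⨆ n : ℕ, ∫⁻ p : EuclideanSpace ℝ (Fin d) × EuclideanSpace ℝ (Fin d),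
        ker c d (dist p.1 p.2) * (min (f p.1) n * min (g p.2) n) ∂(volume.prod volume) := by
        refine lintegral_iSup (fun n => gen _ _ (mfn n) (mgn n)) ?_
        intro n m hnm p
        dsimp only
        have : (n : ℝ≥0∞) ≤ m := by exact_mod_cast hnm
        gcongr
    _ ≤ _ := by
        refine iSup_le fun n => ?_
        rw [lintegral_prod _ (gen _ _ (mfn n) (mgn n)).aemeasurable]
        refine (riesz_bounded hc hd T hT hΩm hΩb hvol (mfn n) (mgn n) (M := n) (by simp)
          (fun x => min_le_right _ _) (fun x => min_le_right _ _)
          (fun x hx => by simp [f_zero x hx]) (fun x hx => by simp [g_zero x hx])).trans ?_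
        gcongr <;> exact min_le_left _ _

theorem main_bound {c : ℝ} (hc : 0 ≤ c) (hd : 3 ≤ d) {r : ℝ}
    (Ω : Set (EuclideanSpace ℝ (Fin d))) (hΩm : MeasurableSet Ω) (hΩb : Bornology.IsBounded Ω)
    (hvol : volume Ω ≤ volume (ball (0 : EuclideanSpace ℝ (Fin d)) r))
    (TΩ : Lp ℝ 2 (volume.restrict Ω) →L[ℝ] Lp ℝ 2 (volume.restrict Ω))
    (TB : Lp ℝ 2 (volume.restrict (ball (0 : EuclideanSpace ℝ (Fin d)) r)) →L[ℝ]
          Lp ℝ 2 (volume.restrict (ball (0 : EuclideanSpace ℝ (Fin d)) r)))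
    (hTΩ : ∀ f, ∀ᵐ x ∂(volume.restrict Ω),
      TΩ f x = ∫ y in Ω, c * dist x y ^ ((2 : ℝ) - d) * f y)
    (hTB : ∀ f, ∀ᵐ x ∂(volume.restrict (ball (0 : EuclideanSpace ℝ (Fin d)) r)),
      TB f x = ∫ y in ball (0 : EuclideanSpace ℝ (Fin d)) r, c * dist x y ^ ((2 : ℝ) - d) * f y) :
    ‖TΩ‖ ≤ ‖TB‖ := by
  have hne0 : Nonempty (Fin d) := ⟨⟨0, by omega⟩⟩
  have hk := measurable_ker (d := d) c hd
  refine ContinuousLinearMap.opNorm_le_bound _ (norm_nonneg _) fun u => ?_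
  set v := TΩ u with hv
  have mu : Measurable fun x => ‖u x‖ₑ := (Lp.stronglyMeasurable u).measurable.enorm
  have mv : Measurable fun x => ‖v x‖ₑ := (Lp.stronglyMeasurable v).measurable.enorm
  have hsq : ∀ w : Lp ℝ 2 (volume.restrict Ω),
      (∫⁻ x, (Ω.indicator (fun x => ‖w x‖ₑ) x) ^ (2 : ℝ)) ^ (1 / 2 : ℝ) = ‖w‖ₑ := by
    intro w
    rw [enorm_Lp_eq, ← lintegral_indicator hΩm]
    congr 1
    refine lintegral_congr fun x => ?_
    by_cases hx : x ∈ Ω <;> simp [hx]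
  have hfin : ∀ (w : Lp ℝ 2 (volume.restrict Ω)) x, Ω.indicator (fun x => ‖w x‖ₑ) x ≠ ⊤ := by
    intro w x
    by_cases hx : x ∈ Ω <;> simp [hx]
  have hz : ∀ (w : Lp ℝ 2 (volume.restrict Ω)) x, x ∉ Ω →
      Ω.indicator (fun x => ‖w x‖ₑ) x = 0 := fun w x hx => Set.indicator_of_notMem hx _
  have hR := riesz_finite hc hd TB hTB hΩm hΩb hvol (mv.indicator hΩm) (mu.indicator hΩm)
    (hfin v) (hfin u) (hz v) (hz u)
  rw [hsq, hsq] at hR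
  have h1 : ‖v‖ₑ * ‖v‖ₑ ≤ ‖TB‖ₑ * (‖v‖ₑ * ‖u‖ₑ) := by
    refine le_trans ?_ hR
    have e0 : ‖v‖ₑ * ‖v‖ₑ = ∫⁻ x in Ω, ‖v x‖ₑ * ‖v x‖ₑ := by
      have h := enorm_Lp_eq v
      rw [h, ← ENNReal.rpow_add_of_nonneg _ _ (by norm_num) (by norm_num)]
      norm_num
      simp only [sq]
    rw [e0, ← lintegral_indicator hΩm]
    have hae := (ae_restrict_iff' hΩm).1 (hTΩ u)
    refine lintegral_mono_ae ?_
    filter_upwards [hae] with x hx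
    by_cases hxΩ : x ∈ Ω
    swap
    · simp [hxΩ]
    have hne : ∀ᵐ y ∂(volume.restrict Ω), y ≠ x := ae_restrict_of_ae (by
      simp [ae_iff, measure_singleton])
    simp only [Set.indicator_of_mem hxΩ]
    calc ‖v x‖ₑ * ‖v x‖ₑ ≤ ‖v x‖ₑ * ∫⁻ y in Ω, ker c d (dist x y) * ‖u y‖ₑ := by
          gcongr
          rw [hv, hx hxΩ]
          refine (enorm_integral_le_lintegral_enorm _).trans (le_of_eq ?_)
          refine lintegral_congr_ae ?_
          filter_upwards [hne] with y hy
          have hy' : 0 < dist x y := dist_pos.2 hy.symm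
          rw [enorm_mul, Real.enorm_eq_ofReal (by positivity), ker_eq hc hy']
      _ = _ := by
          rw [← lintegral_const_mul _ (by exact (hk.comp measurable_prodMk_left).mul mu),
            ← lintegral_indicator hΩm]
          refine lintegral_congr fun y => ?_
          by_cases hy : y ∈ Ω
          · simp only [Set.indicator_of_mem hy]
            ring
          · simp [hy]
  have h2 : ‖v‖ * ‖v‖ ≤ ‖TB‖ * (‖v‖ * ‖u‖) := by
    simp only [← ofReal_norm, ← ENNReal.ofReal_mul (norm_nonneg _)] at h1
    exact (ENNReal.ofReal_le_ofReal_iff (by positivity)).1 h1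
  rcases (norm_nonneg v).eq_or_lt with h | h
  · rw [← h]; positivity
  · refine le_of_mul_le_mul_left ?_ h
    linarith

end Operator

end NewtonRFK

open MeasureTheory Metric

/-- Rayleigh–Faber–Krahn type inequality for the Newton potential, `d ≥ 3`:
if `B` is the ball centred at the origin with `|B| = |Ω|`, then
`‖N_Ω‖ ≤ ‖N_B‖` (equivalently `μ₁(B) ≤ μ₁(Ω)` for the smallest characteristic
numbers). -/
theorem newton_potential_opNorm_le_ball
    (d : ℕ) (hd : 3 ≤ d) (Ω : Set (EuclideanSpace ℝ (Fin d))) (hΩo : IsOpen Ω)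
    (hΩb : Bornology.IsBounded Ω) (r : ℝ) (hr : 0 < r)
    (hvol : volume Ω = volume (ball (0 : EuclideanSpace ℝ (Fin d)) r))
    (TΩ : Lp ℝ 2 (volume.restrict Ω) →L[ℝ] Lp ℝ 2 (volume.restrict Ω))
    (TB : Lp ℝ 2 (volume.restrict (ball (0 : EuclideanSpace ℝ (Fin d)) r)) →L[ℝ]
          Lp ℝ 2 (volume.restrict (ball (0 : EuclideanSpace ℝ (Fin d)) r)))
    (hTΩ : ∀ f, ∀ᵐ x ∂(volume.restrict Ω),
      TΩ f x = ∫ y in Ω,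
        (1 / (((d : ℝ) - 2) * (2 * Real.pi ^ ((d : ℝ) / 2) / Real.Gamma ((d : ℝ) / 2)))) *
          dist x y ^ ((2 : ℝ) - d) * f y)
    (hTB : ∀ f, ∀ᵐ x ∂(volume.restrict (ball (0 : EuclideanSpace ℝ (Fin d)) r)),
      TB f x = ∫ y in ball (0 : EuclideanSpace ℝ (Fin d)) r,
        (1 / (((d : ℝ) - 2) * (2 * Real.pi ^ ((d : ℝ) / 2) / Real.Gamma ((d : ℝ) / 2)))) *
          dist x y ^ ((2 : ℝ) - d) * f y) :
    ‖TΩ‖ ≤ ‖TB‖ := by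

  have hd' : (3 : ℝ) ≤ d := by exact_mod_cast hd
  have hc : 0 ≤ 1 / (((d : ℝ) - 2) *
      (2 * Real.pi ^ ((d : ℝ) / 2) / Real.Gamma ((d : ℝ) / 2))) := by
    have h1 : 0 ≤ (d : ℝ) - 2 := by linarith
    have h2 : 0 < Real.Gamma ((d : ℝ) / 2) := Real.Gamma_pos_of_pos (by linarith)
    positivity
  exact NewtonRFK.main_bound hc hd Ω hΩo.measurableSet hΩb hvol.le TΩ TB hTΩ hTB
end
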